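/- Let N ≥ 2 and let SU(N) be the special unitary group equipped with the Hilbert–Schmidt norm distance and the normalized Haar probability measure ν. Let L be a countable label set, let h : SU(N) → L be a measurable classifier, let η ∈ (0, 1/2] be such that ν(h⁻¹{l}) ≤ 1 − η for every l ∈ L, and let γ ∈ (0, 1]. If the prediction-change adversarial risk satisfies R^{PC}_ε(h, ν) ≤ 1 − γ, then ε ≤ √(4/N) · ( √(ln(2√2/η)) + √(ln(2√2/γ)) ). -/

import Mathlib

open MeasureTheory Metric Finset
open scoped ComplexOrder ENNReal Matrix

noncomputable section

/-- Hilbert–Schmidt (Frobenius) norm distance between two complex matrices. -/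
def hsDist {m : Type*} [Fintype m] (A B : Matrix m m ℂ) : ℝ :=
  Real.sqrt (((A - B)ᴴ * (A - B)).trace.re)

namespace SUConc

abbrev Mat (N : ℕ) := Matrix (Fin N) (Fin N) ℂ
abbrev SUg (N : ℕ) := Matrix.specialUnitaryGroup (Fin N) ℂ

/-- Membership in the Lie algebra `su(N)`. -/
def IsSu {N : ℕ} (X : Mat N) : Prop := Xᴴ = -X ∧ X.trace = 0

lemma IsSu.smul {N : ℕ} {X : Mat N} (h : IsSu X) (s : ℝ) : IsSu (s • X) := by
  refine ⟨?_, ?_⟩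
  · rw [Matrix.conjTranspose_smul, h.1]; simp
  · rw [Matrix.trace_smul, h.2]; simp

lemma IsSu.add {N : ℕ} {X Y : Mat N} (h : IsSu X) (h' : IsSu Y) : IsSu (X + Y) := by
  refine ⟨?_, ?_⟩
  · rw [Matrix.conjTranspose_add, h.1, h'.1]; abel
  · rw [Matrix.trace_add, h.2, h'.2]; simp

lemma IsSu.sum {N : ℕ} {ι : Type*} (s : Finset ι) {X : ι → Mat N} (h : ∀ i, IsSu (X i)) :
    IsSu (∑ i ∈ s, X i) := by
  classical
  induction s using Finset.induction_on with
  | empty => exact ⟨by simp, by simp⟩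
  | insert a s ha ih => rw [Finset.sum_insert ha]; exact (h a).add ih

lemma IsSu.bracket {N : ℕ} {X Y : Mat N} (h : IsSu X) (h' : IsSu Y) :
    IsSu (X * Y - Y * X) := by
  refine ⟨?_, ?_⟩
  · rw [Matrix.conjTranspose_sub, Matrix.conjTranspose_mul, Matrix.conjTranspose_mul, h.1, h'.1]
    simp
  · rw [Matrix.trace_sub, Matrix.trace_mul_comm]; simp

lemma exp_mem_unitary {N : ℕ} {X : Mat N} (h : Xᴴ = -X) :
    NormedSpace.exp X ∈ Matrix.unitaryGroup (Fin N) ℂ := by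
  rw [Matrix.mem_unitaryGroup_iff', Matrix.star_eq_conjTranspose, ← Matrix.exp_conjTranspose, h,
    ← Matrix.exp_add_of_commute]
  · simp
  · exact (Commute.refl X).neg_left

lemma det_exp_antiherm {N : ℕ} {X : Mat N} (h : Xᴴ = -X) :
    (NormedSpace.exp X).det = Complex.exp X.trace := by
  set H : Mat N := Complex.I • X with hH
  have hHh : H.IsHermitian := by
    unfold Matrix.IsHermitian
    rw [hH, Matrix.conjTranspose_smul, h]; simp
  have hX : X = (-Complex.I) • H := by
    rw [hH, smul_smul]; simp
  have hs := hHh.spectral_theorem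
  rw [Unitary.conjStarAlgAut_apply] at hs
  set V := hHh.eigenvectorUnitary with hV
  set d : Fin N → ℂ := fun i => -Complex.I * (hHh.eigenvalues i : ℂ) with hd
  have hVV : (V : Mat N) * star (V : Mat N) = 1 := by
    exact Unitary.mul_star_self_of_mem V.2
  have hVV' : star (V : Mat N) * (V : Mat N) = 1 := by
    exact Unitary.star_mul_self_of_mem V.2
  have hunit : IsUnit (V : Mat N) := ⟨⟨V, star (V : Mat N), hVV, hVV'⟩, rfl⟩
  have hinv : (V : Mat N)⁻¹ = star (V : Mat N) := Matrix.inv_eq_right_inv hVV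
  have hX2 : X = (V : Mat N) * Matrix.diagonal d * (V : Mat N)⁻¹ := by
    rw [hinv, hX, hs]
    rw [← Matrix.smul_mul, ← Matrix.mul_smul]
    congr 2
    ext i j
    by_cases hij : i = j
    · subst hij; simp [hd]
    · simp [hij]
  have htr : X.trace = ∑ i, d i := by
    rw [hX2, Matrix.trace_mul_comm, ← mul_assoc, hinv, hVV', one_mul, Matrix.trace_diagonal]
  rw [htr, hX2, Matrix.exp_conj _ _ hunit, Matrix.exp_diagonal, Matrix.det_conj hunit,
    Matrix.det_diagonal, Complex.exp_sum]
  refine Finset.prod_congr rfl fun i _ => ?_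
  rw [Pi.coe_exp, Complex.exp_eq_exp_ℂ]

lemma exp_mem {N : ℕ} {X : Mat N} (h : IsSu X) :
    NormedSpace.exp X ∈ Matrix.specialUnitaryGroup (Fin N) ℂ := by
  rw [Matrix.mem_specialUnitaryGroup_iff]
  refine ⟨exp_mem_unitary h.1, ?_⟩
  rw [det_exp_antiherm h.1, h.2, Complex.exp_zero]

section log
open scoped Matrix.Norms.L2Operator

lemma exists_log {N : ℕ} (U : Mat N) (hU : U ∈ Matrix.unitaryGroup (Fin N) ℂ) :
    ∃ Y : Mat N, Yᴴ = -Y ∧ NormedSpace.exp Y = U := by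
  have hU' : U ∈ unitary (Mat N) := hU
  let _ : CStarAlgebra (Mat N) := { }
  refine ⟨Complex.I • (Unitary.argSelfAdjoint (⟨U, hU'⟩ : unitary (Mat N)) : Mat N), ?_, ?_⟩
  · rw [Matrix.conjTranspose_smul]
    have := (Unitary.argSelfAdjoint (⟨U, hU'⟩ : unitary (Mat N))).2
    rw [selfAdjoint.mem_iff, Matrix.star_eq_conjTranspose] at this
    rw [this]; simp
  · have hfin : (spectrum ℂ U).Finite := by
      exact Module.End.finite_spectrum (Matrix.toLin' U) |>.subset (by
        rw [Matrix.spectrum_toLin'])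
    have hcont : ContinuousOn Complex.arg (spectrum ℂ U) := hfin.continuousOn _
    have : IsStarNormal U := by
      constructor
      change star U * U = U * star U
      rw [Unitary.star_mul_self_of_mem hU', Unitary.mul_star_self_of_mem hU']
    rw [Unitary.argSelfAdjoint_coe, ← CFC.exp_eq_normedSpace_exp (𝕜 := ℂ),
      ← cfc_comp_smul .., ← cfc_comp' ..]
    conv_rhs => rw [← cfc_id' ℂ (U : Mat N)]
    refine cfc_congr fun y hy ↦ ?_
    have hy₁ : ‖y‖ = 1 := spectrum.norm_eq_one_of_unitary hU' hy
    have : Complex.I * y.arg = Complex.log y :=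
      Complex.ext (by simp [Complex.log_re, hy₁]) (by simp [Complex.log_im])
    have hy0 : y ≠ 0 := by rintro rfl; simp at hy₁
    simpa [← Complex.exp_eq_exp_ℂ, this] using Complex.exp_log hy0

end log

lemma su_generate {N : ℕ} (hN : 0 < N) (U : Mat N)
    (hU : U ∈ Matrix.specialUnitaryGroup (Fin N) ℂ) :
    ∃ Y Z : Mat N, IsSu Y ∧ IsSu Z ∧ NormedSpace.exp Y * NormedSpace.exp Z = U := by
  rw [Matrix.mem_specialUnitaryGroup_iff] at hU
  obtain ⟨W, hW, hWU⟩ := exists_log U hU.1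
  have hdet := det_exp_antiherm hW
  rw [hWU, hU.2, eq_comm, Complex.exp_eq_one_iff] at hdet
  obtain ⟨k, hk⟩ := hdet
  set c : ℂ := k * (2 * Real.pi * Complex.I) / N with hc
  have hNc : (N : ℂ) ≠ 0 := by exact_mod_cast hN.ne'
  have hcs : star c = -c := by
    simp [hc, neg_div]
  let i0 : Fin N := ⟨0, hN⟩
  set d : Fin N → ℂ := fun i => c - if i = i0 then k * (2 * Real.pi * Complex.I) else 0 with hd
  refine ⟨W - Matrix.diagonal (fun _ => c), Matrix.diagonal d, ⟨?_, ?_⟩, ⟨?_, ?_⟩, ?_⟩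
  · rw [Matrix.conjTranspose_sub, hW, Matrix.diagonal_conjTranspose]
    have : (star (fun _ : Fin N => c)) = fun _ => -c := by ext; simp [hcs]
    rw [this, ← Matrix.diagonal_neg]; abel
  · rw [Matrix.trace_sub, hk, Matrix.trace_diagonal]
    simp [hc]; field_simp; simp
  · rw [Matrix.diagonal_conjTranspose, Matrix.diagonal_neg]
    congr 1
    ext i
    simp only [hd, Pi.star_apply, Pi.neg_apply, star_sub, hcs]
    split_ifs <;> simp <;> ring
  · rw [Matrix.trace_diagonal]
    simp [hd, hc]; field_simp; simp
  · have hexp : NormedSpace.exp (Matrix.diagonal d : Mat N)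
        = NormedSpace.exp (Matrix.diagonal (fun _ => c) : Mat N) := by
      rw [Matrix.exp_diagonal, Matrix.exp_diagonal]
      congr 1
      ext i
      rw [Pi.coe_exp, Pi.coe_exp, ← Complex.exp_eq_exp_ℂ, hd]
      simp only
      split_ifs
      · rw [Complex.exp_sub, Complex.exp_int_mul_two_pi_mul_I, div_one]
      · simp
    have hcomm : Commute (Matrix.diagonal (fun _ => c) : Mat N) W := by
      have : (Matrix.diagonal (fun _ => c) : Mat N) = c • (1 : Mat N) := by
        ext i j; by_cases hij : i = j <;> simp [hij]
      rw [this]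
      exact (Commute.one_left W).smul_left c
    rw [hexp, ← Matrix.exp_add_of_commute, sub_add_cancel, hWU]
    exact (hcomm.symm.sub_left (Commute.refl _))

end SUConc

namespace SUConc

/-- Real Hilbert–Schmidt inner product. -/
def ip {N : ℕ} (A B : Mat N) : ℝ := (Aᴴ * B).trace.re

lemma ip_add_left {N : ℕ} (A B C : Mat N) : ip (A + B) C = ip A C + ip B C := by
  simp [ip, add_mul]
lemma ip_add_right {N : ℕ} (A B C : Mat N) : ip A (B + C) = ip A B + ip A C := by
  simp [ip, mul_add]
lemma ip_sub_left {N : ℕ} (A B C : Mat N) : ip (A - B) C = ip A C - ip B C := by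
  simp [ip, sub_mul]
lemma ip_sub_right {N : ℕ} (A B C : Mat N) : ip A (B - C) = ip A B - ip A C := by
  simp [ip, mul_sub]
lemma ip_smul_left {N : ℕ} (r : ℝ) (A B : Mat N) : ip (r • A) B = r * ip A B := by
  simp [ip]
lemma ip_smul_right {N : ℕ} (r : ℝ) (A B : Mat N) : ip A (r • B) = r * ip A B := by
  simp [ip]
lemma ip_neg_left {N : ℕ} (A B : Mat N) : ip (-A) B = - ip A B := by
  simp [ip]
lemma ip_neg_right {N : ℕ} (A B : Mat N) : ip A (-B) = - ip A B := by
  simp [ip]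
lemma ip_comm {N : ℕ} (A B : Mat N) : ip A B = ip B A := by
  have : (Aᴴ * B).trace = star ((Bᴴ * A).trace) := by
    rw [← Matrix.trace_conjTranspose, Matrix.conjTranspose_mul, Matrix.conjTranspose_conjTranspose]
  simp [ip, this]
lemma ip_sum_left {N : ℕ} {ι : Type*} (s : Finset ι) (f : ι → Mat N) (B : Mat N) :
    ip (∑ i ∈ s, f i) B = ∑ i ∈ s, ip (f i) B := by
  simp [ip, Finset.sum_mul, Matrix.conjTranspose_sum, Matrix.trace_sum]
lemma ip_sum_right {N : ℕ} {ι : Type*} (s : Finset ι) (f : ι → Mat N) (B : Mat N) :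
    ip B (∑ i ∈ s, f i) = ∑ i ∈ s, ip B (f i) := by
  simp [ip, Finset.mul_sum, Matrix.trace_sum]
lemma ip_conj {N : ℕ} (A B : Mat N) : ip Aᴴ Bᴴ = ip A B := by
  rw [ip_comm A B]
  simp only [ip, Matrix.conjTranspose_conjTranspose]
  rw [Matrix.trace_mul_comm]
lemma ip_I_smul {N : ℕ} (A B : Mat N) : ip (Complex.I • A) (Complex.I • B) = ip A B := by
  simp only [ip, Matrix.conjTranspose_smul, Matrix.smul_mul, Matrix.mul_smul, smul_smul]
  simp

/-- Projection to `su(N)`. -/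
def prL (N : ℕ) : Mat N →ₗ[ℝ] Mat N where
  toFun M := (1 / 2 : ℂ) • (M - Mᴴ) - (1 / (2 * N) * (M - Mᴴ).trace : ℂ) • (1 : Mat N)
  map_add' A B := by
    simp only [Matrix.conjTranspose_add, Matrix.trace_sub, Matrix.trace_add]
    module
  map_smul' r A := by
    simp only [Matrix.conjTranspose_smul, Matrix.trace_sub, Matrix.trace_smul, star_trivial,
      RingHom.id_apply, Complex.real_smul]
    ext i j
    simp
    ring

lemma prL_apply {N : ℕ} (M : Mat N) : prL N M =
    (1 / 2 : ℂ) • (M - Mᴴ) - (1 / (2 * N) * (M - Mᴴ).trace : ℂ) • (1 : Mat N) := rfl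

lemma prL_isSu {N : ℕ} (hN : 0 < N) (M : Mat N) : IsSu (prL N M) := by
  have hNc : (N : ℂ) ≠ 0 := by exact_mod_cast hN.ne'
  refine ⟨?_, ?_⟩
  · rw [prL_apply]
    ext i j
    by_cases hij : i = j
    · subst hij
      simp [Matrix.trace_conjTranspose]
      ring
    · have hji : ¬ j = i := fun h => hij h.symm
      simp [hij, hji]
      ring
  · rw [prL_apply]
    simp
    field_simp
    ring

lemma prL_of_isSu {N : ℕ} {Y : Mat N} (h : IsSu Y) : prL N Y = Y := by
  rw [prL_apply, h.1, Matrix.trace_sub, Matrix.trace_neg, h.2]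
  ext i j
  simp
  ring

lemma ip_prL {N : ℕ} {Y : Mat N} (h : IsSu Y) (M : Mat N) : ip (prL N M) Y = ip M Y := by
  have h1 : (Mᴴᴴ * Y).trace.re = - (Mᴴ * Y).trace.re := by
    have : (Mᴴ * Y).trace.re = (Mᴴᴴ * Yᴴ).trace.re := (ip_conj M Y).symm
    rw [this, h.1]; simp
  have h2 : (prL N M) = (1 / 2 : ℝ) • (M - Mᴴ) -
      (1 / (2 * N) * (M - Mᴴ).trace : ℂ) • (1 : Mat N) := by
    rw [prL_apply]; congr 1; ext i j; simp
  rw [h2, ip_sub_left, ip_smul_left, ip_sub_left]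
  have h3 : ip ((1 / (2 * N) * (M - Mᴴ).trace : ℂ) • (1 : Mat N)) Y = 0 := by
    simp only [ip, Matrix.conjTranspose_smul, Matrix.smul_mul, Matrix.conjTranspose_one, one_mul,
      Matrix.trace_smul, h.2]
    simp
  rw [h3]
  unfold ip
  rw [h1]; ring

abbrev Ix (N : ℕ) := Fin N × Fin N × Bool

def eb {N : ℕ} (a : Ix N) : Mat N := Matrix.single a.1 a.2.1 (if a.2.2 then Complex.I else 1)

def fr {N : ℕ} (a : Ix N) : Mat N := prL N (eb a)

lemma ip_eb {N : ℕ} (a : Ix N) (M : Mat N) :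
    ip (eb a) M = if a.2.2 then (M a.1 a.2.1).im else (M a.1 a.2.1).re := by
  obtain ⟨j, k, b⟩ := a
  cases b <;> simp [ip, eb, Matrix.conjTranspose_single, Matrix.trace_single_mul]

lemma eb_expand {N : ℕ} (M : Mat N) : ∑ a, ip (eb a) M • eb a = M := by
  have : ∀ j k : Fin N, ∑ b : Bool, ip (eb (j, k, b)) M • eb (j, k, b)
      = Matrix.single j k (M j k) := by
    intro j k
    simp only [Fintype.sum_bool, ip_eb]
    simp only [eb, Matrix.smul_single, ← Matrix.single_add]
    congr 1
    apply Complex.ext <;> simp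
  rw [Fintype.sum_prod_type]
  simp only [Fintype.sum_prod_type, this]
  exact (Matrix.matrix_eq_sum_single M).symm

lemma fr_isSu {N : ℕ} (hN : 0 < N) (a : Ix N) : IsSu (fr a) := prL_isSu hN _

lemma frame_expand {N : ℕ} {Y : Mat N} (h : IsSu Y) : ∑ a, ip (fr a) Y • fr a = Y := by
  conv_rhs => rw [← prL_of_isSu h, ← eb_expand Y, map_sum]
  refine Finset.sum_congr rfl fun a _ => ?_
  rw [map_smul, fr, ip_prL h]

lemma frame_parseval {N : ℕ} {Y : Mat N} (h : IsSu Y) : ∑ a, ip (fr a) Y ^ 2 = ip Y Y := by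
  conv_rhs => rw [← frame_expand h, ip_sum_left]
  refine Finset.sum_congr rfl fun a _ => ?_
  rw [ip_smul_left, frame_expand h, sq]

lemma ip_bracket {N : ℕ} {X Y Z : Mat N} (hX : IsSu X) (hY : IsSu Y) :
    ip X (Y * Z - Z * Y) = ip (X * Y - Y * X) Z := by
  have h := (hX.bracket hY).1
  unfold ip
  rw [h, hX.1]
  simp only [mul_sub, neg_mul, sub_mul, Matrix.trace_sub, Matrix.trace_neg, ← mul_assoc]
  have : (X * Z * Y).trace = (Y * X * Z).trace := by
    rw [Matrix.trace_mul_comm, ← mul_assoc]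
  rw [this]; simp; ring

lemma killing {N : ℕ} {g : Mat N} (hg : IsSu g) :
    ∑ b, ip (fr b * g - g * fr b) (fr b * g - g * fr b) = 2 * N * ip g g := by
  have hbr : ∀ M : Mat N, prL N M * g - g * prL N M
      = (1 / 2 : ℝ) • ((M * g - g * M) - (Mᴴ * g - g * Mᴴ)) := by
    intro M
    rw [prL_apply]
    simp only [sub_mul, mul_sub, Matrix.smul_mul, Matrix.mul_smul, one_mul, mul_one]
    ext i j
    simp
    ring
  have hstar : ∀ M : Mat N, (Mᴴ * g - g * Mᴴ) = (M * g - g * M)ᴴ := by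
    intro M
    rw [Matrix.conjTranspose_sub, Matrix.conjTranspose_mul, Matrix.conjTranspose_mul, hg.1]
    simp
    abel
  have hpair : ∀ j k : Fin N, ∑ b : Bool, ip (fr (j, k, b) * g - g * fr (j, k, b))
      (fr (j, k, b) * g - g * fr (j, k, b)) =
      ip (Matrix.single j k 1 * g - g * Matrix.single j k 1)
        (Matrix.single j k 1 * g - g * Matrix.single j k 1) := by
    intro j k
    set P := Matrix.single j k (1 : ℂ) * g - g * Matrix.single j k 1 with hP
    have h0 : fr (j, k, false) * g - g * fr (j, k, false) = (1 / 2 : ℝ) • (P - Pᴴ) := by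
      rw [fr, hbr, hstar]; simp [eb, hP]
    have h1 : fr (j, k, true) * g - g * fr (j, k, true)
        = Complex.I • ((1 / 2 : ℝ) • (P + Pᴴ)) := by
      have he : (eb (j, k, true) : Mat N) = Complex.I • Matrix.single j k (1 : ℂ) := by
        simp [eb]
      rw [fr, hbr, hstar, he]
      have : (Complex.I • Matrix.single j k (1 : ℂ)) * g - g * (Complex.I • Matrix.single j k 1)
        = Complex.I • P := by
        rw [hP, Matrix.smul_mul, Matrix.mul_smul, smul_sub]
      rw [this, Matrix.conjTranspose_smul]
      ext i j
      simp
      ring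
    rw [Fintype.sum_bool, h0, h1, ip_I_smul]
    simp only [ip_smul_left, ip_smul_right, ip_add_left, ip_add_right, ip_sub_left, ip_sub_right,
      ip_conj]
    ring
  rw [Fintype.sum_prod_type]
  simp only [Fintype.sum_prod_type, hpair]
  have hterm : ∀ j k : Fin N, ip (Matrix.single j k 1 * g - g * Matrix.single j k 1)
      (Matrix.single j k 1 * g - g * Matrix.single j k 1)
      = ((g * gᴴ) k k).re + ((gᴴ * g) j j).re - 2 * (star (g k k) * g j j).re := by
    intro j k
    simp only [ip_sub_left, ip_sub_right]
    have e1 : ip (Matrix.single j k 1 * g) (Matrix.single j k 1 * g) = ((g * gᴴ) k k).re := by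
      unfold ip
      rw [Matrix.conjTranspose_mul, Matrix.trace_mul_comm, Matrix.conjTranspose_single]
      rw [Matrix.mul_assoc, ← Matrix.mul_assoc g, Matrix.trace_single_mul, ]
      simp
    have e2 : ip (g * Matrix.single j k 1) (g * Matrix.single j k 1) = ((gᴴ * g) j j).re := by
      unfold ip
      rw [Matrix.conjTranspose_mul, Matrix.conjTranspose_single]
      rw [Matrix.mul_assoc, Matrix.trace_single_mul, ← Matrix.mul_assoc]
      simp
    have e3 : ip (Matrix.single j k 1 * g) (g * Matrix.single j k 1)
        = (star (g k k) * g j j).re := by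
      unfold ip
      rw [Matrix.conjTranspose_mul, Matrix.conjTranspose_single, Matrix.mul_assoc,
        Matrix.trace_mul_comm, Matrix.mul_assoc, Matrix.trace_single_mul, Matrix.mul_assoc]
      simp [Matrix.mul_apply, Matrix.single_apply, ite_and]; ring
    rw [ip_comm (g * _) (_ * g), e1, e2, e3]
    ring
  simp only [hterm, Finset.sum_sub_distrib, Finset.sum_add_distrib]
  have s1 : ∑ k, ((g * gᴴ) k k).re = ip g g := by
    unfold ip
    rw [Matrix.trace_mul_comm, Matrix.trace, Complex.re_sum]
    rfl
  have s2 : ∑ k, ((gᴴ * g) k k).re = ip g g := by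
    unfold ip
    rw [Matrix.trace, Complex.re_sum]
    rfl
  have s3 : ∑ j, ∑ k, 2 * (star (g k k) * g j j).re = 0 := by
    have : ∀ j, ∑ k, 2 * (star (g k k) * g j j).re = 2 * (star (g.trace) * g j j).re := by
      intro j
      rw [← Finset.mul_sum, ← Complex.re_sum, ← Finset.sum_mul, ← star_sum]
      rfl
    simp only [this, hg.2]
    simp
  rw [s3]
  simp only [s1, s2, Finset.sum_const, Finset.card_univ, Fintype.card_fin, nsmul_eq_mul,
    ← Finset.mul_sum]
  ring

end SUConc

namespace SUConc

abbrev Sg (N : ℕ) := Fin (Module.finrank ℝ (Mat N))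
abbrev Pol (N : ℕ) := MvPolynomial (Sg N) ℝ

def bas (N : ℕ) : Module.Basis (Sg N) ℝ (Mat N) := Module.finBasis ℝ (Mat N)

/-- Evaluation of a real polynomial at a matrix. -/
def ev {N : ℕ} (U : Mat N) : Pol N →ₐ[ℝ] ℝ := MvPolynomial.aeval (fun s => (bas N).repr U s)

/-- Derivation induced by the linear vector field `U ↦ X * U`. -/
def LD {N : ℕ} (X : Mat N) : Derivation ℝ (Pol N) (Pol N) :=
  MvPolynomial.mkDerivation ℝ fun s =>
    ∑ t, MvPolynomial.C ((bas N).repr (X * bas N t) s) * MvPolynomial.X t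

lemma LD_X {N : ℕ} (X : Mat N) (s : Sg N) : LD X (MvPolynomial.X s) =
    ∑ t, MvPolynomial.C ((bas N).repr (X * bas N t) s) * MvPolynomial.X t :=
  MvPolynomial.mkDerivation_X _ _ _

lemma repr_mul {N : ℕ} (X U : Mat N) (s : Sg N) :
    ∑ t, (bas N).repr (X * bas N t) s * (bas N).repr U t = (bas N).repr (X * U) s := by
  conv_rhs => rw [← (bas N).sum_repr U, Finset.mul_sum, map_sum, Finsupp.finsetSum_apply]
  refine Finset.sum_congr rfl fun t _ => ?_
  rw [Matrix.mul_smul, map_smul, Finsupp.smul_apply, smul_eq_mul, mul_comm]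

lemma ev_X {N : ℕ} (U : Mat N) (s : Sg N) : ev U (MvPolynomial.X s) = (bas N).repr U s := by
  simp [ev]

lemma ev_LD_X {N : ℕ} (X U : Mat N) (s : Sg N) :
    ev U (LD X (MvPolynomial.X s)) = (bas N).repr (X * U) s := by
  rw [LD_X, map_sum, ← repr_mul]
  refine Finset.sum_congr rfl fun t _ => ?_
  rw [map_mul, ev_X]
  simp [ev]

lemma LD_add {N : ℕ} (X Y : Mat N) : LD (X + Y) = LD X + LD Y := by
  apply MvPolynomial.derivation_ext
  intro s
  rw [Derivation.add_apply, LD_X, LD_X, LD_X, ← Finset.sum_add_distrib]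
  refine Finset.sum_congr rfl fun t _ => ?_
  simp [add_mul]

lemma LD_smul {N : ℕ} (r : ℝ) (X : Mat N) : LD (r • X) = r • LD X := by
  apply MvPolynomial.derivation_ext
  intro s
  rw [Derivation.smul_apply, LD_X, LD_X, Finset.smul_sum]
  refine Finset.sum_congr rfl fun t _ => ?_
  simp [MvPolynomial.smul_eq_C_mul, mul_assoc]

def LDl (N : ℕ) : Mat N →ₗ[ℝ] Derivation ℝ (Pol N) (Pol N) where
  toFun := LD
  map_add' := LD_add
  map_smul' := LD_smul

lemma LD_sum {N : ℕ} {ι : Type*} (s : Finset ι) (c : ι → ℝ) (X : ι → Mat N) (p : Pol N) :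
    LD (∑ i ∈ s, c i • X i) p = ∑ i ∈ s, c i • LD (X i) p := by
  classical
  induction s using Finset.induction_on with
  | empty =>
    change LDl N _ p = _
    simp
  | insert a s ha ih =>
    rw [Finset.sum_insert ha, Finset.sum_insert ha, LD_add, Derivation.add_apply, ih, LD_smul,
      Derivation.smul_apply]

lemma LD_LD_X {N : ℕ} (X Y : Mat N) (s : Sg N) : LD X (LD Y (MvPolynomial.X s)) =
    LD (Y * X) (MvPolynomial.X s) := by
  rw [LD_X, LD_X, map_sum]
  simp only [Derivation.leibniz, MvPolynomial.derivation_C, mul_zero, add_zero, LD_X, smul_eq_mul,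
    Finset.mul_sum]
  rw [Finset.sum_comm]
  refine Finset.sum_congr rfl fun u _ => ?_
  rw [mul_assoc, ← repr_mul, map_sum, Finset.sum_mul]
  refine Finset.sum_congr rfl fun t _ => ?_
  rw [MvPolynomial.C_mul, mul_assoc]

lemma LD_bracket {N : ℕ} (X Y : Mat N) (p : Pol N) :
    LD X (LD Y p) - LD Y (LD X p) = LD (Y * X - X * Y) p := by
  have : ⁅LD X, LD Y⁆ = LD (Y * X - X * Y) := by
    apply MvPolynomial.derivation_ext
    intro s
    rw [Derivation.commutator_apply, LD_LD_X, LD_LD_X]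
    change _ = LDl N _ _
    rw [map_sub]; rfl
  rw [← this, Derivation.commutator_apply]

lemma LD_expand {N : ℕ} {Y : Mat N} (h : IsSu Y) (p : Pol N) :
    LD Y p = ∑ a, ip (fr a) Y • LD (fr a) p := by
  rw [← LD_sum, frame_expand h]

/-- Laplacian. -/
def Lap (N : ℕ) : Pol N →ₗ[ℝ] Pol N :=
  ∑ a, (LD (fr a)).toLinearMap ∘ₗ (LD (fr a)).toLinearMap

lemma Lap_apply {N : ℕ} (p : Pol N) : Lap N p = ∑ a, LD (fr a) (LD (fr a) p) := by
  simp [Lap]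

def Gam {N : ℕ} (p : Pol N) : Pol N := ∑ a, (LD (fr a) p) ^ 2

lemma LD_Lap {N : ℕ} (hN : 0 < N) (b : Ix N) (p : Pol N) :
    LD (fr b) (Lap N p) = Lap N (LD (fr b) p) := by
  rw [← sub_eq_zero, Lap_apply, Lap_apply, map_sum, ← Finset.sum_sub_distrib]
  set t : Ix N → Ix N → ℝ := fun c a => ip (fr c) (fr a * fr b - fr b * fr a) with ht
  have hanti : ∀ c a, t c a = - t a c := by
    intro c a
    simp only [ht]
    rw [ip_bracket (fr_isSu hN c) (fr_isSu hN a), ip_bracket (fr_isSu hN a) (fr_isSu hN c)]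
    rw [← neg_sub, ip_neg_left]
  have hbr : ∀ a q, LD (fr b) (LD (fr a) q) = LD (fr a) (LD (fr b) q)
      + ∑ c, t c a • LD (fr c) q := by
    intro a q
    rw [← LD_expand ((fr_isSu hN a).bracket (fr_isSu hN b)), ← LD_bracket]; ring
  have hterm : ∀ a, LD (fr b) (LD (fr a) (LD (fr a) p)) - LD (fr a) (LD (fr a) (LD (fr b) p))
      = ∑ c, t c a • (LD (fr c) (LD (fr a) p) + LD (fr a) (LD (fr c) p)) := by
    intro a
    rw [hbr, hbr, map_add, map_sum]
    simp only [Derivation.map_smul, smul_add, Finset.sum_add_distrib]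
    ring
  simp only [hterm]
  set S := ∑ a, ∑ c, t c a • (LD (fr c) (LD (fr a) p) + LD (fr a) (LD (fr c) p)) with hS
  have hneg : S = -S := by
    conv_lhs => rw [hS, Finset.sum_comm]
    rw [hS, ← Finset.sum_neg_distrib]
    refine Finset.sum_congr rfl fun a _ => ?_
    rw [← Finset.sum_neg_distrib]
    refine Finset.sum_congr rfl fun c _ => ?_
    rw [hanti a c, neg_smul, add_comm]
  exact self_eq_neg.mp hneg

lemma bochner {N : ℕ} (hN : 0 < N) (p : Pol N) :
    Lap N (Gam p) = 2 * ∑ i, ∑ j, (LD (fr i) (LD (fr j) p)) ^ 2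
      + 2 * ∑ j, LD (fr j) p * LD (fr j) (Lap N p) := by
  have h1 : ∀ j, Lap N ((LD (fr j) p) ^ 2) = 2 * ∑ i, (LD (fr i) (LD (fr j) p)) ^ 2
      + 2 * (LD (fr j) p * Lap N (LD (fr j) p)) := by
    intro j
    rw [Lap_apply, Lap_apply, Finset.mul_sum, Finset.mul_sum, Finset.mul_sum,
      ← Finset.sum_add_distrib]
    refine Finset.sum_congr rfl fun i _ => ?_
    simp only [sq, Derivation.leibniz, smul_eq_mul, map_add]
    ring
  unfold Gam
  rw [map_sum]
  simp only [h1, Finset.sum_add_distrib, LD_Lap hN, ← Finset.mul_sum]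
  rw [Finset.sum_comm]

lemma ev_LD_grad {N : ℕ} {Y : Mat N} (h : IsSu Y) (U : Mat N) (p : Pol N) :
    ev U (LD Y p) = ip (∑ c, ev U (LD (fr c) p) • fr c) Y := by
  rw [LD_expand h, map_sum, ip_sum_left]
  refine Finset.sum_congr rfl fun c _ => ?_
  rw [map_smul, ip_smul_left, smul_eq_mul, mul_comm]

lemma grad_isSu {N : ℕ} (hN : 0 < N) (U : Mat N) (p : Pol N) :
    IsSu (∑ c, ev U (LD (fr c) p) • fr c) :=
  IsSu.sum _ fun c => (fr_isSu hN c).smul _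

lemma ev_Gam {N : ℕ} (hN : 0 < N) (U : Mat N) (p : Pol N) :
    ev U (Gam p) = ip (∑ c, ev U (LD (fr c) p) • fr c) (∑ c, ev U (LD (fr c) p) • fr c) := by
  rw [← frame_parseval (grad_isSu hN U p), Gam, map_sum]
  refine Finset.sum_congr rfl fun c _ => ?_
  rw [map_pow, ip_comm, ← ev_LD_grad (fr_isSu hN c)]

/-- Curvature inequality `Γ₂ ≥ (N/2) Γ`. -/
lemma curvature {N : ℕ} (hN : 0 < N) (U : Mat N) (p : Pol N) :
    2 * ev U (∑ j, LD (fr j) p * LD (fr j) (Lap N p)) + N * ev U (Gam p)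
      ≤ ev U (Lap N (Gam p)) := by
  rw [bochner hN, map_add, map_mul, map_mul]
  have h2 : ev U (2 : Pol N) = 2 := map_ofNat _ 2
  rw [h2]
  set g := ∑ c, ev U (LD (fr c) p) • fr c with hg
  have hgs : IsSu g := grad_isSu hN U p
  set x : Ix N → Ix N → ℝ := fun i j => ev U (LD (fr i) (LD (fr j) p)) with hx
  have hxx : ev U (∑ i, ∑ j, (LD (fr i) (LD (fr j) p)) ^ 2) = ∑ i, ∑ j, x i j ^ 2 := by
    simp [hx, map_sum]
  have hdiff : ∀ i j, x i j - x j i = ip (fr i) (fr j * g - g * fr j) * (-1) := by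
    intro i j
    simp only [hx]
    rw [← map_sub, LD_bracket, ev_LD_grad ((fr_isSu hN j).bracket (fr_isSu hN i)), ← hg]
    rw [ip_comm, ← ip_bracket (fr_isSu hN j) (fr_isSu hN i), ip_comm, ← ip_bracket
      (fr_isSu hN i) hgs, ← neg_sub (g * fr j), ip_neg_right]
    ring
  have hsum : ∑ i, ∑ j, (x i j - x j i) ^ 2 = 2 * N * ev U (Gam p) := by
    rw [ev_Gam hN, ← hg, ← killing hgs, Finset.sum_comm]
    refine Finset.sum_congr rfl fun j _ => ?_
    rw [← frame_parseval ((fr_isSu hN j).bracket hgs)]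
    refine Finset.sum_congr rfl fun i _ => ?_
    rw [hdiff]; ring
  have hle : ∑ i, ∑ j, (x i j - x j i) ^ 2 ≤ 4 * ∑ i, ∑ j, x i j ^ 2 := by
    have hcomm : ∑ i, ∑ j, x j i ^ 2 = ∑ i, ∑ j, x i j ^ 2 := Finset.sum_comm
    calc ∑ i, ∑ j, (x i j - x j i) ^ 2 ≤ ∑ i, ∑ j, (2 * x i j ^ 2 + 2 * x j i ^ 2) := by
          refine Finset.sum_le_sum fun i _ => Finset.sum_le_sum fun j _ => ?_
          nlinarith [sq_nonneg (x i j + x j i)]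
      _ = 4 * ∑ i, ∑ j, x i j ^ 2 := by
          simp only [Finset.sum_add_distrib, ← Finset.mul_sum]
          rw [hcomm]; ring
  rw [hxx]
  linarith

lemma totalDegree_LD {N : ℕ} (X : Mat N) (p : Pol N) : (LD X p).totalDegree ≤ p.totalDegree := by
  conv_lhs => rw [p.as_sum, map_sum]
  refine MvPolynomial.totalDegree_finsetSum_le fun s hs => ?_
  unfold LD
  rw [MvPolynomial.mkDerivation_monomial]
  refine (MvPolynomial.totalDegree_smul_le _ _).trans ?_
  refine MvPolynomial.totalDegree_finsetSum_le fun i hi => ?_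
  simp only [smul_eq_mul]
  refine (MvPolynomial.totalDegree_mul _ _).trans ?_
  have h1 : (∑ t, MvPolynomial.C ((bas N).repr (X * bas N t) i) *
      MvPolynomial.X t : Pol N).totalDegree ≤ 1 := by
    refine MvPolynomial.totalDegree_finsetSum_le fun t _ => ?_
    refine (MvPolynomial.totalDegree_mul _ _).trans ?_
    simp
  have h2 : (MvPolynomial.monomial (s - Finsupp.single i 1) ((s i : ℝ))).totalDegree
      ≤ (s - Finsupp.single i 1).sum fun _ e => e := MvPolynomial.totalDegree_monomial_le _ _
  have h3 : ((s - Finsupp.single i 1).sum fun _ e => e) + 1 = s.sum fun _ e => e := by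
    have hle : Finsupp.single i 1 ≤ s := by
      rw [Finsupp.single_le_iff]
      exact Nat.one_le_iff_ne_zero.mpr (Finsupp.mem_support_iff.mp hi)
    conv_rhs => rw [← tsub_add_cancel_of_le hle]
    rw [Finsupp.sum_add_index' (by simp) (by simp)]
    simp
  have h4 := MvPolynomial.le_totalDegree hs
  omega

lemma totalDegree_Lap {N : ℕ} (p : Pol N) : (Lap N p).totalDegree ≤ p.totalDegree := by
  rw [Lap_apply]
  exact MvPolynomial.totalDegree_finsetSum_le fun s _ =>
    (totalDegree_LD _ _).trans (totalDegree_LD _ _)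

end SUConc

namespace SUConc

instance compactSU (N : ℕ) : CompactSpace (SUg N) := by
  suffices h : IsCompact ((Matrix.specialUnitaryGroup (Fin N) ℂ : Submonoid (Mat N)) : Set (Mat N)) from
    isCompact_iff_compactSpace.mp h
  have hK : IsCompact {M : Mat N | ∀ i j, M i j ∈ closedBall (0 : ℂ) 1} := by
    have h := isCompact_univ_pi (X := fun _ : Fin N => Fin N → ℂ)
      (s := fun _ => Set.univ.pi fun _ => closedBall (0 : ℂ) 1)
      (fun _ => isCompact_univ_pi fun _ => isCompact_closedBall _ _)
    have he : {M : Mat N | ∀ i j, M i j ∈ closedBall (0 : ℂ) 1} =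
        (Set.univ.pi fun _ => Set.univ.pi fun _ => closedBall (0 : ℂ) 1) := by
      apply Set.ext
      intro M
      exact ⟨fun h i _ j _ => h i j, fun h i j => h i trivial j trivial⟩
    rw [he]
    exact h
  refine hK.of_isClosed_subset ?_ ?_
  · have : ((Matrix.specialUnitaryGroup (Fin N) ℂ : Submonoid (Mat N)) : Set (Mat N))
      = {M | star M * M = 1} ∩ {M | M.det = 1} := by
      ext M
      rw [SetLike.mem_coe, Matrix.mem_specialUnitaryGroup_iff, Matrix.mem_unitaryGroup_iff']
      rfl
    rw [this]
    refine IsClosed.inter (isClosed_eq ?_ continuous_const) (isClosed_eq ?_ continuous_const)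
    · exact (continuous_star.mul continuous_id)
    · exact Continuous.matrix_det continuous_id
  · intro M hM i j
    have hM' : M ∈ Matrix.unitaryGroup (Fin N) ℂ := (Matrix.mem_specialUnitaryGroup_iff.mp hM).1
    simpa using entry_norm_bound_of_unitary hM' i j

/-- One-parameter subgroup. -/
def eG {N : ℕ} {X : Mat N} (h : IsSu X) (s : ℝ) : SUg N :=
  ⟨NormedSpace.exp (s • X), exp_mem (h.smul s)⟩

lemma eG_zero {N : ℕ} {X : Mat N} (h : IsSu X) : eG h 0 = 1 := by
  apply Subtype.ext
  simp [eG]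

lemma continuous_ev {N : ℕ} (p : Pol N) : Continuous fun U : Mat N => ev U p := by
  have h : ∀ U : Mat N, ev U p = MvPolynomial.eval (fun s => (bas N).repr U s) p := by
    intro U
    exact congrArg (fun φ : Pol N →+* ℝ => φ p)
      (MvPolynomial.coe_aeval_eq_eval (fun s => (bas N).repr U s))
  simp only [h]
  refine (MvPolynomial.continuous_eval p).comp (continuous_pi fun s => ?_)
  exact ((bas N).coord s).continuous_of_finiteDimensional

lemma continuous_evG {N : ℕ} (p : Pol N) : Continuous fun U : SUg N => ev (U : Mat N) p :=
  (continuous_ev p).comp continuous_subtype_val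

section deriv
attribute [local instance] Matrix.frobeniusNormedAddCommGroup Matrix.frobeniusNormedSpace
  Matrix.frobeniusNormedRing Matrix.frobeniusNormedAlgebra

lemma continuous_eG {N : ℕ} {X : Mat N} (h : IsSu X) : Continuous (eG h) := by
  refine Continuous.subtype_mk ?_ _
  exact continuous_iff_continuousAt.mpr fun s => (hasDerivAt_exp_smul_const' X s).continuousAt

lemma hasDerivAt_exp_lin {N : ℕ} (X : Mat N) (s : ℝ) (l : Mat N →ₗ[ℝ] ℝ) :
    HasDerivAt (fun s : ℝ => l (NormedSpace.exp (s • X))) (l (X * NormedSpace.exp (s • X))) s := by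
  have h1 := hasDerivAt_exp_smul_const' X s
  exact (LinearMap.toContinuousLinearMap l).hasFDerivAt.comp_hasDerivAt s h1

lemma hasDerivAt_matexp_mulVec {n : ℕ} (M : Matrix (Fin n) (Fin n) ℝ) (v : Fin n → ℝ) (k : Fin n)
    (t : ℝ) : HasDerivAt (fun t : ℝ => (NormedSpace.exp (t • M) *ᵥ v) k)
      ((M *ᵥ (NormedSpace.exp (t • M) *ᵥ v)) k) t := by
  have h1 := hasDerivAt_exp_smul_const' M t
  let l : Matrix (Fin n) (Fin n) ℝ →ₗ[ℝ] ℝ :=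
    { toFun := fun A => (A *ᵥ v) k
      map_add' := fun A B => by simp [Matrix.add_mulVec]
      map_smul' := fun r A => by simp [Matrix.smul_mulVec] }
  have := (LinearMap.toContinuousLinearMap l).hasFDerivAt.comp_hasDerivAt t h1
  rw [Matrix.mulVec_mulVec]
  exact this

end deriv

lemma hasDerivAt_ev {N : ℕ} (X U : Mat N) (p : Pol N) (s : ℝ) :
    HasDerivAt (fun s : ℝ => ev (NormedSpace.exp (s • X) * U) p)
      (ev (NormedSpace.exp (s • X) * U) (LD X p)) s := by
  induction p using MvPolynomial.induction_on with
  | C a =>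
    rw [MvPolynomial.derivation_C, map_zero]
    have : ∀ V : Mat N, ev V (MvPolynomial.C a) = a := fun V => by simp [ev]
    simp only [this]
    exact hasDerivAt_const _ _
  | add p q hp hq =>
    simp only [map_add]
    exact hp.add hq
  | mul_X p i hp =>
    simp only [map_mul, Derivation.leibniz, smul_eq_mul, map_add, ev_X, ev_LD_X]
    have h1 := hasDerivAt_exp_lin X s
      (((bas N).coord i) ∘ₗ (LinearMap.mulRight ℝ U))
    simp only [LinearMap.comp_apply, LinearMap.mulRight_apply, Module.Basis.coord_apply] at h1
    refine (hp.mul h1).congr_deriv ?_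
    rw [mul_assoc]; ring

lemma hasDerivAt_evG {N : ℕ} {X : Mat N} (h : IsSu X) (U : SUg N) (p : Pol N) (s : ℝ) :
    HasDerivAt (fun s : ℝ => ev ((eG h s * U : SUg N) : Mat N) p)
      (ev ((eG h s * U : SUg N) : Mat N) (LD X p)) s :=
  hasDerivAt_ev X U p s

lemma heat_exists {N : ℕ} (p : Pol N) : ∃ (n : ℕ) (q : Fin n → Pol N) (c c' : ℝ → Fin n → ℝ),
    (∀ t k, HasDerivAt (fun t => c t k) (c' t k) t) ∧ (∑ k, c 0 k • q k = p) ∧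
    ∀ t, ∑ k, c' t k • q k = Lap N (∑ k, c t k • q k) := by
  let d := p.totalDegree
  let V := MvPolynomial.restrictTotalDegree (Sg N) ℝ d
  have hV : ∀ v ∈ V, Lap N v ∈ V := by
    intro v hv
    rw [MvPolynomial.mem_restrictTotalDegree] at hv ⊢
    exact (totalDegree_Lap v).trans hv
  let T : V →ₗ[ℝ] V := (Lap N).restrict hV
  let b := Module.finBasis ℝ V
  let M := LinearMap.toMatrix b b T
  let p0 : V := ⟨p, by rw [MvPolynomial.mem_restrictTotalDegree]⟩
  let c : ℝ → Fin (Module.finrank ℝ V) → ℝ := fun t => NormedSpace.exp (t • M) *ᵥ (b.repr p0)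
  refine ⟨_, fun k => (b k : Pol N), c, fun t => M *ᵥ c t, ?_, ?_, ?_⟩
  · intro t k
    exact hasDerivAt_matexp_mulVec M _ k t
  · have h0 : c 0 = b.repr p0 := by simp [c]
    rw [h0]
    have := congrArg (Subtype.val) (b.sum_repr p0)
    rw [Submodule.coe_sum] at this
    exact this
  · intro t
    let v : V := ∑ k, c t k • b k
    have hrepr : (b.repr v : Fin _ → ℝ) = c t := b.repr_sum_self (c t)
    have h1 := LinearMap.toMatrix_mulVec_repr b b T v
    rw [hrepr] at h1
    have h2 := congrArg (Subtype.val) (b.sum_repr (T v))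
    have h3 : ((T v : V) : Pol N) = Lap N (v : Pol N) := rfl
    have h4 : (v : Pol N) = ∑ k, c t k • (b k : Pol N) := by
      simp only [v]
      rw [Submodule.coe_sum]
      rfl
    rw [h3, h4] at h2
    rw [← h2, Submodule.coe_sum]
    refine Finset.sum_congr rfl fun k _ => ?_
    simp only [M, h1]
    rfl

lemma second_deriv_max {f g : ℝ → ℝ} {c : ℝ} (hf : ∀ s, HasDerivAt f (g s) s)
    (hg : HasDerivAt g c 0) (hmax : ∀ s, f s ≤ f 0) : c ≤ 0 := by
  by_contra hc
  push Not at hc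
  have hd : deriv f = g := funext fun s => (hf s).deriv
  have hloc : IsLocalMax f 0 := Filter.Eventually.of_forall hmax
  have hg0 : g 0 = 0 := hloc.hasDerivAt_eq_zero (hf 0)
  have hmin : IsLocalMin f 0 := isLocalMin_of_deriv_deriv_pos (by rw [hd, hg.deriv]; exact hc)
    (by rw [hd, hg0]) (hf 0).continuousAt
  have heq : f =ᶠ[nhds 0] fun _ => f 0 := by
    filter_upwards [hmin] with s hs
    exact le_antisymm (hmax s) hs
  have h1 : deriv f =ᶠ[nhds 0] deriv (fun _ => f 0) := heq.deriv
  have h2 : deriv (deriv f) 0 = 0 := by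
    rw [h1.deriv_eq]; simp
  rw [hd, hg.deriv] at h2
  exact hc.ne' h2

lemma Lap_le_zero_of_max {N : ℕ} (hN : 0 < N) (p : Pol N) (U : SUg N)
    (hmax : ∀ V : SUg N, ev (V : Mat N) p ≤ ev (U : Mat N) p) : ev (U : Mat N) (Lap N p) ≤ 0 := by
  rw [Lap_apply, map_sum]
  refine Finset.sum_nonpos fun a _ => ?_
  have h := fr_isSu hN a
  refine second_deriv_max (f := fun s => ev ((eG h s * U : SUg N) : Mat N) p)
    (g := fun s => ev ((eG h s * U : SUg N) : Mat N) (LD (fr a) p))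
    (fun s => hasDerivAt_evG h U p s) ?_ ?_
  · have := hasDerivAt_evG h U (LD (fr a) p) 0
    rw [eG_zero, one_mul] at this
    exact this
  · intro s
    simp only [eG_zero, one_mul]
    exact hmax _

/-- Parabolic maximum principle. -/
lemma max_principle {K : Type*} [TopologicalSpace K] [CompactSpace K] (u u' : ℝ → K → ℝ)
    (hc : Continuous (Function.uncurry u)) (hd : ∀ t x, HasDerivAt (fun t => u t x) (u' t x) t)
    (hmax : ∀ t x, (∀ y, u t y ≤ u t x) → u' t x ≤ 0) (C : ℝ) (h0 : ∀ x, u 0 x ≤ C)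
    (t : ℝ) (ht : 0 ≤ t) (x : K) : u t x ≤ C := by
  refine le_of_forall_pos_le_add fun δ hδ => ?_
  obtain ⟨δ', hδ', hle⟩ : ∃ δ' > 0, δ' * t ≤ δ := by
    refine ⟨δ / (t + 1), by positivity, ?_⟩
    rw [div_mul_eq_mul_div, div_le_iff₀ (by positivity)]
    nlinarith
  have hcomp : IsCompact (Set.Icc (0 : ℝ) t ×ˢ (Set.univ : Set K)) := isCompact_Icc.prod isCompact_univ
  have hne : (Set.Icc (0 : ℝ) t ×ˢ (Set.univ : Set K)).Nonempty :=
    ⟨(0, x), ⟨by simp [ht], trivial⟩⟩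
  have hcont : ContinuousOn (fun z : ℝ × K => u z.1 z.2 - δ' * z.1)
      (Set.Icc (0 : ℝ) t ×ˢ (Set.univ : Set K)) := by
    refine Continuous.continuousOn ?_
    exact (hc.sub (continuous_const.mul continuous_fst))
  obtain ⟨⟨t0, x0⟩, ⟨ht0, -⟩, hm⟩ := hcomp.exists_isMaxOn hne hcont
  have hm' : ∀ s ∈ Set.Icc (0 : ℝ) t, ∀ y, u s y - δ' * s ≤ u t0 x0 - δ' * t0 :=
    fun s hs y => hm (show (s, y) ∈ _ from ⟨hs, trivial⟩)
  have ht00 : t0 = 0 := by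
    by_contra hne0
    have hpos : 0 < t0 := lt_of_le_of_ne ht0.1 (Ne.symm hne0)
    have hle0 : u' t0 x0 ≤ 0 := hmax t0 x0 fun y => by
      have := hm' t0 ht0 y
      linarith
    have hder : HasDerivAt (fun s => u s x0 - δ' * s) (u' t0 x0 - δ') t0 := by
      have h2 : HasDerivAt (fun s => u s x0 - δ' * s) (u' t0 x0 - δ' * 1) t0 :=
        (hd t0 x0).sub ((hasDerivAt_id t0).const_mul δ')
      rwa [mul_one] at h2
    have hneg : u' t0 x0 - δ' < 0 := by linarith
    have hmem : ∀ᶠ s in nhdsWithin t0 (Set.Iio t0), s ∈ Set.Icc (0 : ℝ) t := by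
      filter_upwards [Ioo_mem_nhdsLT hpos] with s hs
      exact ⟨hs.1.le, hs.2.le.trans ht0.2⟩
    have hslope := hder.hasDerivWithinAt (s := Set.Iio t0)
    rw [hasDerivWithinAt_iff_tendsto_slope' (by simp)] at hslope
    have hnonneg : ∀ᶠ s in nhdsWithin t0 (Set.Iio t0),
        0 ≤ slope (fun s => u s x0 - δ' * s) t0 s := by
      filter_upwards [hmem, self_mem_nhdsWithin] with s hs hs2
      rw [slope_def_field]
      have := hm' s hs x0
      exact div_nonneg_of_nonpos (by linarith) (by have : s < t0 := hs2; linarith)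
    have := ge_of_tendsto hslope hnonneg
    linarith
  have := hm' t ⟨ht, le_rfl⟩ x
  rw [ht00] at this
  have h00 := h0 x0
  linarith

end SUConc

namespace SUConc

lemma ip_self_eq {N : ℕ} (A : Mat N) : ip A A = ∑ i, ∑ j, ‖A i j‖ ^ 2 := by
  rw [ip, Matrix.trace, Complex.re_sum, Finset.sum_comm]
  refine Finset.sum_congr rfl fun i _ => ?_
  rw [Matrix.diag_apply, Matrix.mul_apply, Complex.re_sum]
  refine Finset.sum_congr rfl fun j _ => ?_
  rw [Matrix.conjTranspose_apply, ← Complex.normSq_eq_norm_sq, Complex.normSq_apply]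
  simp

lemma ip_self_nonneg {N : ℕ} (A : Mat N) : 0 ≤ ip A A := by
  rw [ip_self_eq]; positivity

lemma ip_cs {N : ℕ} (A B : Mat N) : |ip A B| ≤ Real.sqrt (ip A A) * Real.sqrt (ip B B) := by
  rw [← Real.sqrt_mul (ip_self_nonneg A)]
  apply Real.abs_le_sqrt
  have h := discrim_le_zero (a := ip B B) (b := 2 * ip A B) (c := ip A A) (fun x => by
    have := ip_self_nonneg (A + x • B)
    rw [ip_add_left, ip_add_right, ip_add_right, ip_smul_left, ip_smul_left, ip_smul_right,
      ip_smul_right, ip_comm B A] at this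
    linarith)
  rw [discrim] at h
  nlinarith

lemma hsDist_eq {N : ℕ} (A B : Mat N) : hsDist A B = Real.sqrt (ip (A - B) (A - B)) := rfl

lemma ip_mul_unitary_right {N : ℕ} (A : Mat N) {U : Mat N} (hU : U * Uᴴ = 1) :
    ip (A * U) (A * U) = ip A A := by
  rw [ip, ip, Matrix.conjTranspose_mul, Matrix.mul_assoc, Matrix.trace_mul_comm, Matrix.mul_assoc,
    Matrix.mul_assoc, hU, Matrix.mul_one]

lemma ip_mul_unitary_left {N : ℕ} (A : Mat N) {U : Mat N} (hU : Uᴴ * U = 1) :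
    ip (U * A) (U * A) = ip A A := by
  rw [ip, ip, Matrix.conjTranspose_mul, Matrix.mul_assoc, ← Matrix.mul_assoc Uᴴ, hU, Matrix.one_mul]

lemma su_mul_ct {N : ℕ} (U : SUg N) : (U : Mat N) * (U : Mat N)ᴴ = 1 :=
  Matrix.mem_unitaryGroup_iff.mp (Matrix.mem_specialUnitaryGroup_iff.mp U.2).1

lemma su_ct_mul {N : ℕ} (U : SUg N) : (U : Mat N)ᴴ * (U : Mat N) = 1 :=
  Matrix.mem_unitaryGroup_iff'.mp (Matrix.mem_specialUnitaryGroup_iff.mp U.2).1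

lemma hsDist_mul_right {N : ℕ} (A B : Mat N) (U : SUg N) :
    hsDist (A * (U : Mat N)) (B * (U : Mat N)) = hsDist A B := by
  rw [hsDist_eq, hsDist_eq, ← sub_mul, ip_mul_unitary_right _ (su_mul_ct U)]

lemma hsDist_mul_left {N : ℕ} (A B : Mat N) (U : SUg N) :
    hsDist ((U : Mat N) * A) ((U : Mat N) * B) = hsDist A B := by
  rw [hsDist_eq, hsDist_eq, ← mul_sub, ip_mul_unitary_left _ (su_ct_mul U)]

section normed
attribute [local instance] Matrix.frobeniusNormedAddCommGroup Matrix.frobeniusNormedSpace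
  Matrix.frobeniusNormedRing Matrix.frobeniusNormedAlgebra

lemma frob_norm {N : ℕ} (A : Mat N) : ‖A‖ = Real.sqrt (ip A A) := by
  rw [Matrix.frobenius_norm_def, Real.sqrt_eq_rpow, ip_self_eq]
  simp

lemma hsDist_eq_norm {N : ℕ} (A B : Mat N) : hsDist A B = ‖A - B‖ := by
  rw [frob_norm, hsDist_eq]

lemma hsDist_triangle {N : ℕ} (A B C : Mat N) : hsDist A C ≤ hsDist A B + hsDist B C := by
  simp only [hsDist_eq_norm]
  exact norm_sub_le_norm_sub_add_norm_sub A B C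

lemma hsDist_comm {N : ℕ} (A B : Mat N) : hsDist A B = hsDist B A := by
  simp only [hsDist_eq_norm]
  exact norm_sub_rev A B

lemma hsDist_self {N : ℕ} (A : Mat N) : hsDist A A = 0 := by
  simp [hsDist_eq_norm]

lemma hsDist_eq_zero {N : ℕ} {A B : Mat N} (h : hsDist A B = 0) : A = B := by
  rw [hsDist_eq_norm, norm_eq_zero, sub_eq_zero] at h
  exact h

lemma Gam_le_one {N : ℕ} (hN : 0 < N) (p : Pol N)
    (hp : ∀ U V : SUg N, |ev (U : Mat N) p - ev (V : Mat N) p| ≤ hsDist (U : Mat N) (V : Mat N))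
    (U : SUg N) : ev (U : Mat N) (Gam p) ≤ 1 := by
  rw [ev_Gam hN]
  set g := ∑ c, ev (U : Mat N) (LD (fr c) p) • fr c with hg
  have hgs : IsSu g := grad_isSu hN _ p
  have h1 := hasDerivAt_evG hgs U p 0
  rw [eG_zero, one_mul, ev_LD_grad hgs, ← hg, hasDerivAt_iff_tendsto_slope] at h1
  have h2 := hasDerivAt_exp_smul_const' g (0 : ℝ)
  rw [hasDerivAt_iff_tendsto_slope] at h2
  have h3 := h2.norm
  have h4 := le_of_tendsto_of_tendsto h1 h3 (by
    filter_upwards [] with s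
    rw [slope_def_field, slope_def_module, norm_smul]
    simp only [sub_zero, zero_smul]
    refine (le_abs_self _).trans ?_
    rw [abs_div, div_eq_inv_mul, norm_inv, Real.norm_eq_abs]
    refine mul_le_mul_of_nonneg_left ?_ (by positivity)
    refine (hp _ _).trans_eq ?_
    have := hsDist_mul_right (eG hgs s : Mat N) (eG hgs 0 : Mat N) U
    rw [← hsDist_eq_norm]
    refine Eq.trans this ?_
    simp [eG]
    rfl)
  rw [zero_smul, NormedSpace.exp_zero, mul_one, frob_norm] at h4
  have h5 := Real.mul_self_sqrt (ip_self_nonneg g)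
  have h6 := Real.sqrt_nonneg (ip g g)
  nlinarith

end normed

lemma heat_flow {N : ℕ} (p : Pol N) : ∃ f : ℝ → Pol N, f 0 = p ∧
    (∀ (L : Pol N →ₗ[ℝ] Pol N) (U : Mat N) (t : ℝ),
      HasDerivAt (fun t => ev U (L (f t))) (ev U (L (Lap N (f t)))) t) ∧
    (∀ L : Pol N →ₗ[ℝ] Pol N, Continuous fun z : ℝ × SUg N => ev (z.2 : Mat N) (L (f z.1))) := by
  obtain ⟨n, q, c, c', hc, h0, hL⟩ := heat_exists p
  have hexp : ∀ (L : Pol N →ₗ[ℝ] Pol N) (U : Mat N) (a : Fin n → ℝ),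
      ev U (L (∑ k, a k • q k)) = ∑ k, a k * ev U (L (q k)) := by
    intro L U a
    simp only [map_sum, map_smul, smul_eq_mul]
  refine ⟨fun t => ∑ k, c t k • q k, h0, ?_, ?_⟩
  · intro L U t
    simp only [← hL, hexp]
    exact HasDerivAt.fun_sum fun k _ => (hc t k).mul_const _
  · intro L
    simp only [hexp]
    refine continuous_finsetSum _ fun k _ => ?_
    refine Continuous.mul ?_ ((continuous_evG _).comp continuous_snd)
    have : Continuous fun t => c t k := continuous_iff_continuousAt.mpr fun t => (hc t k).continuousAt
    exact this.comp continuous_fst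

section flow
variable {N : ℕ} {f : ℝ → Pol N}

lemma Gam_eval (U : Mat N) (p : Pol N) : ev U (Gam p) = ∑ a, (ev U (LD (fr a) p)) ^ 2 := by
  simp [Gam, map_sum]

lemma Gam_decay (hN : 0 < N)
    (hd : ∀ (L : Pol N →ₗ[ℝ] Pol N) (U : Mat N) (t : ℝ),
      HasDerivAt (fun t => ev U (L (f t))) (ev U (L (Lap N (f t)))) t)
    (hc : ∀ L : Pol N →ₗ[ℝ] Pol N, Continuous fun z : ℝ × SUg N => ev (z.2 : Mat N) (L (f z.1)))
    (C : ℝ) (h0 : ∀ U : SUg N, ev (U : Mat N) (Gam (f 0)) ≤ C) (t : ℝ) (ht : 0 ≤ t) (U : SUg N) :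
    ev (U : Mat N) (Gam (f t)) ≤ C * Real.exp (-(N * t)) := by
  have key := max_principle (K := SUg N)
    (fun t U => Real.exp (N * t) * ev (U : Mat N) (Gam (f t)))
    (fun t U => (N * Real.exp (N * t)) * ev (U : Mat N) (Gam (f t)) + Real.exp (N * t) *
      (2 * ev (U : Mat N) (∑ j, LD (fr j) (f t) * LD (fr j) (Lap N (f t)))))
    ?_ ?_ ?_ C ?_ t ht U
  · rw [Real.exp_neg, ← div_eq_mul_inv, le_div_iff₀ (Real.exp_pos _), mul_comm]
    exact key
  · simp only [Function.uncurry_def, Gam_eval]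
    refine Continuous.mul (by fun_prop) (continuous_finsetSum _ fun a _ => ?_)
    exact (hc (LD (fr a)).toLinearMap).pow 2
  · intro t U
    have h1 : HasDerivAt (fun t : ℝ => Real.exp (N * t)) (N * Real.exp (N * t)) t := by
      have := ((hasDerivAt_id t).const_mul (N : ℝ)).exp
      simp only [id, mul_one] at this
      exact this.congr_deriv (mul_comm _ _)
    have h2 : HasDerivAt (fun t => ev (U : Mat N) (Gam (f t)))
        (2 * ev (U : Mat N) (∑ j, LD (fr j) (f t) * LD (fr j) (Lap N (f t)))) t := by
      simp only [Gam_eval, map_sum, map_mul, Finset.mul_sum]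
      refine HasDerivAt.fun_sum fun a _ => ?_
      have := (hd (LD (fr a)).toLinearMap (U : Mat N) t).pow 2
      refine this.congr_deriv ?_
      simp
      ring
    exact h1.mul h2
  · intro t U hmax
    have hpos := Real.exp_pos (N * t)
    have h1 := Lap_le_zero_of_max hN (Gam (f t)) U fun V => by
      have := hmax V
      simpa [hpos] using this
    have h2 := curvature hN (U : Mat N) (f t)
    nlinarith
  · intro U
    simpa using h0 U

lemma sup_decay (hN : 0 < N)
    (hd : ∀ (L : Pol N →ₗ[ℝ] Pol N) (U : Mat N) (t : ℝ),
      HasDerivAt (fun t => ev U (L (f t))) (ev U (L (Lap N (f t)))) t)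
    (hc : ∀ L : Pol N →ₗ[ℝ] Pol N, Continuous fun z : ℝ × SUg N => ev (z.2 : Mat N) (L (f z.1)))
    (B : ℝ) (h0 : ∀ U : SUg N, |ev (U : Mat N) (f 0)| ≤ B) (t : ℝ) (ht : 0 ≤ t) (U : SUg N) :
    |ev (U : Mat N) (f t)| ≤ B := by
  rw [abs_le']
  constructor
  · refine max_principle (K := SUg N) (fun t U => ev (U : Mat N) (f t))
      (fun t U => ev (U : Mat N) (Lap N (f t))) (hc LinearMap.id)
      (fun t U => hd LinearMap.id U t) ?_ B (fun U => (le_abs_self _).trans (h0 U)) t ht U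
    intro t U h
    exact Lap_le_zero_of_max hN _ U h
  · refine max_principle (K := SUg N) (fun t U => -ev (U : Mat N) (f t))
      (fun t U => -ev (U : Mat N) (Lap N (f t))) (hc LinearMap.id).neg
      (fun t U => (hd LinearMap.id U t).neg) ?_ B (fun U => (neg_le_abs _).trans (h0 U)) t ht U
    intro t U h
    have := Lap_le_zero_of_max hN (-(f t)) U (by simpa using h)
    simpa using this

/-- Lipschitz estimate along one-parameter subgroups. -/
lemma exp_diff_le (hN : 0 < N) (p : Pol N) (C : ℝ)
    (hC : ∀ U : SUg N, ev (U : Mat N) (Gam p) ≤ C) {Y : Mat N} (hY : IsSu Y) (U : SUg N) :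
    |ev ((eG hY 1 * U : SUg N) : Mat N) p - ev (U : Mat N) p| ≤
      Real.sqrt C * Real.sqrt (ip Y Y) := by
  have := Convex.norm_image_sub_le_of_norm_hasDerivWithin_le (𝕜 := ℝ)
    (f := fun s : ℝ => ev ((eG hY s * U : SUg N) : Mat N) p)
    (f' := fun s => ev ((eG hY s * U : SUg N) : Mat N) (LD Y p))
    (s := Set.univ) (x := 0) (y := 1) (C := Real.sqrt C * Real.sqrt (ip Y Y))
    (fun s _ => (hasDerivAt_evG hY U p s).hasDerivWithinAt) (fun s _ => by
      rw [ev_LD_grad hY, Real.norm_eq_abs]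
      refine (ip_cs _ _).trans ?_
      rw [← ev_Gam hN]
      gcongr
      exact hC _) convex_univ trivial trivial
  simpa [eG_zero] using this

lemma diff_tendsto (hN : 0 < N)
    (h : ∀ t, 0 ≤ t → ∀ U : SUg N, ev (U : Mat N) (Gam (f t)) ≤ Real.exp (-(N * t))) (U V : SUg N) :
    Filter.Tendsto (fun t => ev (U : Mat N) (f t) - ev (V : Mat N) (f t)) Filter.atTop (nhds 0) := by
  obtain ⟨Y, Z, hY, hZ, hYZ⟩ := su_generate hN ((U * V⁻¹ : SUg N) : Mat N) (U * V⁻¹ : SUg N).2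
  have hU : eG hY 1 * (eG hZ 1 * V) = U := by
    have : eG hY 1 * eG hZ 1 = U * V⁻¹ := by
      apply Subtype.ext
      simp only [← hYZ, eG, one_smul]
      rfl
    rw [← mul_assoc, this, inv_mul_cancel_right]
  have hlim : Filter.Tendsto (fun t : ℝ => Real.sqrt (Real.exp (-(N * t))) *
      (Real.sqrt (ip Y Y) + Real.sqrt (ip Z Z))) Filter.atTop (nhds 0) := by
    have h1 : Filter.Tendsto (fun t : ℝ => Real.exp (-(N * t))) Filter.atTop (nhds 0) := by
      refine Real.tendsto_exp_neg_atTop_nhds_zero.comp ?_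
      exact Filter.tendsto_id.const_mul_atTop (by exact_mod_cast hN)
    have h2 := (h1.sqrt).mul_const (Real.sqrt (ip Y Y) + Real.sqrt (ip Z Z))
    simpa using h2
  refine squeeze_zero_norm' ?_ hlim
  filter_upwards [Filter.eventually_ge_atTop 0] with t ht
  have h1 := exp_diff_le hN (f t) _ (h t ht) hY (eG hZ 1 * V)
  have h2 := exp_diff_le hN (f t) _ (h t ht) hZ V
  rw [hU] at h1
  rw [Real.norm_eq_abs, mul_add]
  refine le_trans ?_ (add_le_add h1 h2)
  exact abs_sub_le _ _ _

end flow

end SUConc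

namespace SUConc

section integ
variable {N : ℕ} [MeasurableSpace (SUg N)] [BorelSpace (SUg N)]

lemma integ_cont (ν : Measure (SUg N)) [IsProbabilityMeasure ν] {u : SUg N → ℝ} (hu : Continuous u) :
    Integrable u ν :=
  hu.integrable_of_hasCompactSupport (HasCompactSupport.of_compactSpace u)

lemma hasDerivAt_int (ν : Measure (SUg N)) [IsProbabilityMeasure ν] (u u' : ℝ → SUg N → ℝ)
    (hu : Continuous (Function.uncurry u)) (hu' : Continuous (Function.uncurry u'))
    (hd : ∀ t U, HasDerivAt (fun t => u t U) (u' t U) t) (t0 : ℝ) :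
    HasDerivAt (fun t => ∫ U, u t U ∂ν) (∫ U, u' t0 U ∂ν) t0 := by
  have hut : ∀ t, Continuous (u t) := fun t => hu.comp (Continuous.prodMk_right t)
  have hut' : ∀ t, Continuous (u' t) := fun t => hu'.comp (Continuous.prodMk_right t)
  have hcomp : IsCompact (closedBall t0 1 ×ˢ (Set.univ : Set (SUg N))) :=
    (isCompact_closedBall t0 1).prod isCompact_univ
  obtain ⟨B, hB⟩ := hcomp.exists_bound_of_continuousOn hu'.continuousOn
  refine (hasDerivAt_integral_of_dominated_loc_of_deriv_le (s := closedBall t0 1)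
    (bound := fun _ => B) (closedBall_mem_nhds t0 one_pos)
    (Filter.Eventually.of_forall fun t => (hut t).aestronglyMeasurable)
    (integ_cont ν (hut t0)) (hut' t0).aestronglyMeasurable ?_ (integrable_const B) ?_).2
  · exact Filter.Eventually.of_forall fun U t ht => hB (t, U) ⟨ht, trivial⟩
  · exact Filter.Eventually.of_forall fun U t _ => hd t U

/-- Left invariance. -/
def LInv (ν : Measure (SUg N)) : Prop :=
  ∀ (W : SUg N) (S : Set (SUg N)), MeasurableSet S → ν ((fun U => W * U) ⁻¹' S) = ν S

lemma LInv.map {ν : Measure (SUg N)} (hν : LInv ν) (W : SUg N) :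
    Measure.map (fun U => W * U) ν = ν := by
  ext S hS
  rw [Measure.map_apply (continuous_const_mul W).measurable hS]
  exact hν W S hS

lemma LInv.int {ν : Measure (SUg N)} (hν : LInv ν) (W : SUg N) {u : SUg N → ℝ} (hu : Continuous u) :
    ∫ U, u (W * U) ∂ν = ∫ U, u U ∂ν := by
  conv_rhs => rw [← hν.map W]
  rw [integral_map (continuous_const_mul W).measurable.aemeasurable
    hu.aestronglyMeasurable]

lemma ibp0 {ν : Measure (SUg N)} [IsProbabilityMeasure ν] (hν : LInv ν) {X : Mat N} (hX : IsSu X)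
    {u w : SUg N → ℝ} (hu : Continuous u) (hw : Continuous w)
    (hd : ∀ s U, HasDerivAt (fun s => u (eG hX s * U)) (w (eG hX s * U)) s) : ∫ U, w U ∂ν = 0 := by
  have hm : Continuous fun z : ℝ × SUg N => eG hX z.1 * z.2 :=
    ((continuous_eG hX).comp continuous_fst).mul continuous_snd
  have h1 := hasDerivAt_int ν (fun s U => u (eG hX s * U)) (fun s U => w (eG hX s * U))
    (hu.comp hm) (hw.comp hm) hd 0
  simp only [hν.int _ hu, hν.int _ hw] at h1
  exact h1.unique (hasDerivAt_const _ _)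

lemma ibp {ν : Measure (SUg N)} [IsProbabilityMeasure ν] (hν : LInv ν) (hN : 0 < N) (l : ℝ)
    (p : Pol N) : ∫ U : SUg N, Real.exp (l * ev (U : Mat N) p) * ev (U : Mat N) (Lap N p) ∂ν =
      - l * ∫ U : SUg N, Real.exp (l * ev (U : Mat N) p) * ev (U : Mat N) (Gam p) ∂ν := by
  have hE : Continuous fun U : SUg N => Real.exp (l * ev (U : Mat N) p) :=
    Real.continuous_exp.comp (continuous_const.mul (continuous_evG p))
  have key : ∀ a : Ix N, ∫ U : SUg N, Real.exp (l * ev (U : Mat N) p) *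
      (ev (U : Mat N) (LD (fr a) (LD (fr a) p)) + l * ev (U : Mat N) (LD (fr a) p) ^ 2) ∂ν = 0 := by
    intro a
    refine ibp0 hν (fr_isSu hN a)
      (u := fun U => Real.exp (l * ev (U : Mat N) p) * ev (U : Mat N) (LD (fr a) p))
      (hE.mul (continuous_evG _))
      (hE.mul ((continuous_evG _).add (continuous_const.mul ((continuous_evG _).pow 2)))) ?_
    intro s U
    have h1 := hasDerivAt_evG (fr_isSu hN a) U p s
    have h2 := hasDerivAt_evG (fr_isSu hN a) U (LD (fr a) p) s
    refine (((h1.const_mul l).exp).mul h2).congr_deriv ?_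
    ring
  rw [neg_mul, ← add_eq_zero_iff_eq_neg, ← integral_const_mul, ← integral_add]
  · rw [← Finset.sum_const_zero (s := (Finset.univ : Finset (Ix N))), ← Finset.sum_congr rfl
      (fun a _ => key a), ← integral_finsetSum]
    · refine integral_congr_ae (Filter.Eventually.of_forall fun U => ?_)
      simp only [Lap_apply, Gam_eval, map_sum, Finset.mul_sum, mul_add, Finset.sum_add_distrib]
      congr 1
      refine Finset.sum_congr rfl fun a _ => ?_
      ring
    · intro a _
      exact integ_cont ν (hE.mul ((continuous_evG _).add
        (continuous_const.mul ((continuous_evG _).pow 2))))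
  · exact integ_cont ν (hE.mul (continuous_evG _))
  · exact integ_cont ν (continuous_const.mul (hE.mul (continuous_evG _)))

lemma laplace_poly {ν : Measure (SUg N)} [IsProbabilityMeasure ν] (hν : LInv ν) (hN : 0 < N) (l : ℝ)
    (p : Pol N)
    (hp : ∀ U V : SUg N, |ev (U : Mat N) p - ev (V : Mat N) p| ≤ hsDist (U : Mat N) (V : Mat N)) :
    ∫ U : SUg N, Real.exp (l * ev (U : Mat N) p) ∂ν ≤
      Real.exp (l ^ 2 / N + l * ∫ U : SUg N, ev (U : Mat N) p ∂ν) := by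
  obtain ⟨f, hf0, hd, hc⟩ := heat_flow p
  have hNr : (0 : ℝ) < N := by exact_mod_cast hN
  have hG : ∀ t, 0 ≤ t → ∀ U : SUg N, ev (U : Mat N) (Gam (f t)) ≤ Real.exp (-(N * t)) := by
    intro t ht U
    have := Gam_decay hN hd hc 1 (by rw [hf0]; exact Gam_le_one hN p hp) t ht U
    rwa [one_mul] at this
  obtain ⟨B, hB⟩ := (isCompact_univ (X := SUg N)).exists_bound_of_continuousOn
    (continuous_evG p).continuousOn
  have hB' : ∀ t, 0 ≤ t → ∀ U : SUg N, |ev (U : Mat N) (f t)| ≤ B := by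
    refine sup_decay hN hd hc B ?_
    intro U
    rw [hf0]
    exact hB U trivial
  have hcE : Continuous fun z : ℝ × SUg N => ev (z.2 : Mat N) (f z.1) := hc LinearMap.id
  have hcL : Continuous fun z : ℝ × SUg N => ev (z.2 : Mat N) (Lap N (f z.1)) := hc (Lap N)
  have hdE : ∀ t (U : SUg N), HasDerivAt (fun t => ev (U : Mat N) (f t))
    (ev (U : Mat N) (Lap N (f t))) t := fun t U => hd LinearMap.id U t
  -- the mean is constant
  have hmean : ∀ t, ∫ U : SUg N, ev (U : Mat N) (f t) ∂ν = ∫ U : SUg N, ev (U : Mat N) p ∂ν := by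
    have h1 : ∀ t, HasDerivAt (fun t => ∫ U : SUg N, ev (U : Mat N) (f t) ∂ν) 0 t := by
      intro t
      have h2 := hasDerivAt_int ν (fun t U => ev (U : Mat N) (f t))
        (fun t U => ev (U : Mat N) (Lap N (f t))) hcE hcL hdE t
      have h3 := ibp hν hN 0 (f t)
      simp only [zero_mul, Real.exp_zero, one_mul, neg_zero] at h3
      rwa [h3] at h2
    intro t
    have := is_const_of_deriv_eq_zero (fun t => (h1 t).differentiableAt) (fun t => (h1 t).deriv) t 0
    rw [this, hf0]
  set m := ∫ U : SUg N, ev (U : Mat N) p ∂ν with hm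
  -- derivative of the Laplace functional
  set φ : ℝ → ℝ := fun t => ∫ U : SUg N, Real.exp (l * ev (U : Mat N) (f t)) ∂ν with hφ
  have hφd : ∀ t, HasDerivAt φ
      (- l ^ 2 * ∫ U : SUg N, Real.exp (l * ev (U : Mat N) (f t)) * ev (U : Mat N) (Gam (f t)) ∂ν) t := by
    intro t
    have hcX : Continuous fun z : ℝ × SUg N => Real.exp (l * ev (z.2 : Mat N) (f z.1)) :=
      Real.continuous_exp.comp (continuous_const.mul hcE)
    have h2 := hasDerivAt_int ν (fun t U => Real.exp (l * ev (U : Mat N) (f t)))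
        (fun t U => l * (Real.exp (l * ev (U : Mat N) (f t)) * ev (U : Mat N) (Lap N (f t))))
        hcX (continuous_const.mul (hcX.mul hcL)) (fun t U => by
          refine (((hdE t U).const_mul l).exp).congr_deriv ?_
          ring) t
    refine h2.congr_deriv ?_
    rw [integral_const_mul, ibp hν hN l (f t)]
    ring
  have hφb : ∀ t, 0 ≤ t → ∫ U : SUg N, Real.exp (l * ev (U : Mat N) (f t)) *
      ev (U : Mat N) (Gam (f t)) ∂ν ≤ Real.exp (-(N * t)) * φ t := by
    intro t ht
    have hE : Continuous fun U : SUg N => Real.exp (l * ev (U : Mat N) (f t)) :=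
      Real.continuous_exp.comp (continuous_const.mul (continuous_evG _))
    rw [hφ, ← integral_const_mul]
    refine integral_mono (integ_cont ν (hE.mul (continuous_evG _)))
      (integ_cont ν (continuous_const.mul hE)) fun U => ?_
    simp only
    rw [mul_comm]
    exact mul_le_mul_of_nonneg_right (hG t ht U) (Real.exp_pos _).le
  set ψ : ℝ → ℝ := fun t => φ t * Real.exp (-(l ^ 2 / N * Real.exp (-(N * t)))) with hψ
  have hψd : ∀ t, HasDerivAt ψ
      ((- l ^ 2 * ∫ U : SUg N, Real.exp (l * ev (U : Mat N) (f t)) * ev (U : Mat N) (Gam (f t)) ∂ν)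
        * Real.exp (-(l ^ 2 / N * Real.exp (-(N * t)))) +
        φ t * (Real.exp (-(l ^ 2 / N * Real.exp (-(N * t)))) * (l ^ 2 * Real.exp (-(N * t))))) t := by
    intro t
    refine (hφd t).mul ?_
    have h1 : HasDerivAt (fun t : ℝ => -((N : ℝ) * t)) (-((N : ℝ) * 1)) t :=
      ((hasDerivAt_id t).const_mul (N : ℝ)).neg
    refine ((h1.exp.const_mul (l ^ 2 / N)).neg.exp).congr_deriv ?_
    field_simp
    rfl
  have hmono : MonotoneOn ψ (Set.Ici 0) := by
    refine monotoneOn_of_deriv_nonneg (convex_Ici 0)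
      (fun t _ => (hψd t).continuousAt.continuousWithinAt)
      (fun t _ => (hψd t).differentiableAt.differentiableWithinAt) ?_
    intro t ht
    rw [interior_Ici] at ht
    rw [(hψd t).deriv]
    have h1 := hφb t (le_of_lt ht)
    have h2 := Real.exp_pos (-(l ^ 2 / N * Real.exp (-(N * t))))
    have h3 := mul_nonneg (mul_nonneg (sq_nonneg l) h2.le) (sub_nonneg.mpr h1)
    nlinarith
  -- limits
  have hpt : ∀ U : SUg N, Filter.Tendsto (fun t => ev (U : Mat N) (f t)) Filter.atTop (nhds m) := by
    intro U
    have h1 : Filter.Tendsto (fun t => ∫ V : SUg N, (ev (U : Mat N) (f t) - ev (V : Mat N) (f t)) ∂ν)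
        Filter.atTop (nhds (∫ _ : SUg N, (0 : ℝ) ∂ν)) := by
      refine tendsto_integral_filter_of_dominated_convergence (fun _ => 2 * B) ?_ ?_
        (integrable_const _) ?_
      · exact Filter.Eventually.of_forall fun t =>
          (continuous_const.sub (continuous_evG _)).aestronglyMeasurable
      · filter_upwards [Filter.eventually_ge_atTop 0] with t ht
        refine Filter.Eventually.of_forall fun V => ?_
        rw [Real.norm_eq_abs]
        refine (abs_sub _ _).trans ?_
        linarith [hB' t ht U, hB' t ht V]
      · exact Filter.Eventually.of_forall fun V => diff_tendsto hN hG U V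
    have h2 : ∀ t, ∫ V : SUg N, (ev (U : Mat N) (f t) - ev (V : Mat N) (f t)) ∂ν =
        ev (U : Mat N) (f t) - m := by
      intro t
      rw [integral_sub (integrable_const _) (integ_cont ν (continuous_evG _)), hmean t]
      simp
    simp only [h2, integral_zero] at h1
    have h3 := h1.add_const m
    simpa using h3
  have hφlim : Filter.Tendsto φ Filter.atTop (nhds (Real.exp (l * m))) := by
    have h1 : Filter.Tendsto φ Filter.atTop (nhds (∫ _ : SUg N, Real.exp (l * m) ∂ν)) := by
      refine tendsto_integral_filter_of_dominated_convergence (fun _ => Real.exp (|l| * B)) ?_ ?_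
        (integrable_const _) ?_
      · exact Filter.Eventually.of_forall fun t =>
          (Real.continuous_exp.comp (continuous_const.mul (continuous_evG _))).aestronglyMeasurable
      · filter_upwards [Filter.eventually_ge_atTop 0] with t ht
        refine Filter.Eventually.of_forall fun V => ?_
        rw [Real.norm_eq_abs, Real.abs_exp]
        refine Real.exp_le_exp.mpr ((le_abs_self _).trans ?_)
        rw [abs_mul]
        exact mul_le_mul_of_nonneg_left (hB' t ht V) (abs_nonneg _)
      · exact Filter.Eventually.of_forall fun V =>
          (Real.continuous_exp.tendsto _).comp ((hpt V).const_mul l)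
    simpa using h1
  have hle : ∀ᶠ t in Filter.atTop, ψ 0 ≤ φ t := by
    filter_upwards [Filter.eventually_ge_atTop 0] with t ht
    refine (hmono (Set.mem_Ici.mpr le_rfl) (Set.mem_Ici.mpr ht) ht).trans ?_
    have hφ0 : 0 ≤ φ t := integral_nonneg fun U => (Real.exp_pos _).le
    refine mul_le_of_le_one_right hφ0 (Real.exp_le_one_iff.mpr ?_)
    have := Real.exp_pos (-(N * t))
    have h2 : 0 ≤ l ^ 2 / N := by positivity
    nlinarith
  have hfin := ge_of_tendsto hφlim hle
  have hψ0 : ψ 0 = (∫ U : SUg N, Real.exp (l * ev (U : Mat N) p) ∂ν) * Real.exp (-(l ^ 2 / N)) := by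
    simp [hψ, hφ, hf0]
  rw [hψ0, Real.exp_neg, ← div_eq_mul_inv, div_le_iff₀ (Real.exp_pos _)] at hfin
  rw [add_comm, Real.exp_add]
  exact hfin

end integ

end SUConc

namespace SUConc

section approx
variable {N : ℕ}

lemma ip_self_su (U : SUg N) : ip (U : Mat N) (U : Mat N) = N := by
  rw [ip, su_ct_mul]
  simp

def kap (U V : SUg N) : ℝ := 2 * N + 2 * ip (V : Mat N) (U : Mat N)

lemma kap_eq (U V : SUg N) : kap U V = 4 * N - hsDist (U : Mat N) (V : Mat N) ^ 2 := by
  rw [hsDist_eq, Real.sq_sqrt (ip_self_nonneg _), ip_sub_left, ip_sub_right, ip_sub_right,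
    ip_self_su, ip_self_su, kap, ip_comm (U : Mat N) (V : Mat N)]
  ring

lemma kap_nonneg (U V : SUg N) : 0 ≤ kap U V := by
  have h := ip_cs (V : Mat N) (U : Mat N)
  rw [ip_self_su, ip_self_su, Real.mul_self_sqrt (by positivity)] at h
  have := (abs_le.mp h).1
  rw [kap]
  linarith

lemma kap_mul_left (W U V : SUg N) : kap (W * U) (W * V) = kap U V := by
  rw [kap_eq, kap_eq]
  have := hsDist_mul_left (U : Mat N) (V : Mat N) W
  rw [← this]
  rfl

lemma continuous_ip_right (A : Mat N) : Continuous fun B : Mat N => ip A B := by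
  let l : Mat N →ₗ[ℝ] ℝ :=
    { toFun := fun B => ip A B
      map_add' := fun B C => ip_add_right A B C
      map_smul' := fun r B => ip_smul_right r A B }
  exact l.continuous_of_finiteDimensional

lemma continuous_ip_left (A : Mat N) : Continuous fun B : Mat N => ip B A := by
  have : (fun B : Mat N => ip B A) = fun B => ip A B := funext fun B => ip_comm B A
  rw [this]
  exact continuous_ip_right A

lemma continuous_kap (U : SUg N) : Continuous fun V => kap U V :=
  continuous_const.add (continuous_const.mul
    ((continuous_ip_left (U : Mat N)).comp continuous_subtype_val))

lemma kap_expand (U V : SUg N) : kap U V = 2 * N +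
    ∑ s, ev (U : Mat N) (MvPolynomial.X s) * (2 * ip (V : Mat N) (bas N s)) := by
  have h : ip (V : Mat N) (U : Mat N) = ∑ s, (bas N).repr (U : Mat N) s * ip (V : Mat N) (bas N s) := by
    conv_lhs => rw [← (bas N).sum_repr (U : Mat N), ip_sum_right]
    exact Finset.sum_congr rfl fun s _ => ip_smul_right _ _ _
  rw [kap, h, Finset.mul_sum]
  congr 1
  refine Finset.sum_congr rfl fun s _ => ?_
  rw [ev_X]; ring

variable [MeasurableSpace (SUg N)] [BorelSpace (SUg N)]

lemma kap_poly (ν : Measure (SUg N)) [IsProbabilityMeasure ν] (n : ℕ) :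
    ∀ G : SUg N → ℝ, Continuous G → ∃ P : Pol N, ∀ U : SUg N,
      ev (U : Mat N) P = ∫ V, G V * kap U V ^ n ∂ν := by
  induction n with
  | zero =>
    intro G _
    refine ⟨MvPolynomial.C (∫ V, G V ∂ν), fun U => ?_⟩
    simp [ev]
  | succ n ih =>
    intro G hG
    obtain ⟨P0, hP0⟩ := ih (fun V => G V * (2 * N)) (hG.mul continuous_const)
    have hcs : ∀ s, Continuous fun V : SUg N => G V * (2 * ip (V : Mat N) (bas N s)) := fun s =>
      hG.mul (continuous_const.mul ((continuous_ip_left _).comp continuous_subtype_val))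
    choose P hP using fun s => ih (fun V => G V * (2 * ip (V : Mat N) (bas N s))) (hcs s)
    refine ⟨P0 + ∑ s, MvPolynomial.X s * P s, fun U => ?_⟩
    simp only [map_add, map_sum, map_mul, hP0, hP]
    simp only [← integral_const_mul]
    rw [← integral_finsetSum, ← integral_add]
    · refine integral_congr_ae (Filter.Eventually.of_forall fun V => ?_)
      simp only
      rw [pow_succ]
      nth_rewrite 4 [kap_expand]
      rw [mul_add, mul_add, Finset.mul_sum, Finset.mul_sum]
      congr 1
      · ring
      · refine Finset.sum_congr rfl fun s _ => ?_
        ring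
    · exact integ_cont ν ((hG.mul continuous_const).mul ((continuous_kap U).pow n))
    · exact integ_cont ν (continuous_finsetSum _ fun s _ =>
        continuous_const.mul ((hcs s).mul ((continuous_kap U).pow n)))
    · exact fun s _ => integ_cont ν (continuous_const.mul ((hcs s).mul ((continuous_kap U).pow n)))

lemma continuous_dist_one (W : SUg N) :
    Continuous fun V : SUg N => hsDist (W : Mat N) (V : Mat N) := by
  have h1 : Continuous fun V : SUg N => (W : Mat N) - (V : Mat N) :=
    continuous_const.sub continuous_subtype_val
  exact Real.continuous_sqrt.comp
    (Complex.continuous_re.comp ((h1.matrix_conjTranspose.matrix_mul h1).matrix_trace))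

lemma ball_pos {ν : Measure (SUg N)} [IsProbabilityMeasure ν] (hν : LInv ν) (r : ℝ) (hr : 0 < r) :
    0 < ν.real {V : SUg N | hsDist ((1 : SUg N) : Mat N) (V : Mat N) < r} := by
  have hopen : ∀ W : SUg N, IsOpen {V : SUg N | hsDist (W : Mat N) (V : Mat N) < r} := fun W =>
    isOpen_lt (continuous_dist_one W) continuous_const
  rw [measureReal_def, ENNReal.toReal_pos_iff]
  refine ⟨pos_iff_ne_zero.mpr fun h0 => ?_, measure_lt_top _ _⟩
  have : ν Set.univ = 0 := by
    refine isCompact_univ.measure_zero_of_nhdsWithin fun W _ => ?_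
    refine ⟨{V : SUg N | hsDist (W : Mat N) (V : Mat N) < r}, mem_nhdsWithin_of_mem_nhds
      ((hopen W).mem_nhds (by simpa [hsDist_self] using hr)), ?_⟩
    rw [← hν W _ (hopen W).measurableSet, ← h0]
    congr 1
    ext V
    simp only [Set.mem_preimage, Set.mem_ofPred_eq]
    have := hsDist_mul_left ((1 : SUg N) : Mat N) (V : Mat N) W
    rw [← this]
    simp
  rw [measure_univ] at this
  exact one_ne_zero this

lemma approx_poly {ν : Measure (SUg N)} [IsProbabilityMeasure ν] (hν : LInv ν) (hN : 0 < N)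
    (F : SUg N → ℝ) (hFc : Continuous F)
    (hF : ∀ U V : SUg N, |F U - F V| ≤ hsDist (U : Mat N) (V : Mat N)) (δ : ℝ) (hδ : 0 < δ)
    (hδ1 : δ ≤ 1) :
    ∃ p : Pol N, (∀ U V : SUg N, |ev (U : Mat N) p - ev (V : Mat N) p| ≤
      hsDist (U : Mat N) (V : Mat N)) ∧ ∀ U : SUg N, |ev (U : Mat N) p - F U| ≤ δ := by
  have hN1 : (1 : ℝ) ≤ N := by exact_mod_cast hN
  set D : SUg N → ℝ := fun V => hsDist ((1 : SUg N) : Mat N) (V : Mat N) with hD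
  have hDc : Continuous D := continuous_dist_one 1
  set k : SUg N → ℝ := fun V => kap 1 V with hk
  have hkc : Continuous k := continuous_kap 1
  have hkD : ∀ V, k V = 4 * N - D V ^ 2 := fun V => kap_eq 1 V
  have hk0 : ∀ V, 0 ≤ k V := fun V => kap_nonneg 1 V
  have hD0 : ∀ V, 0 ≤ D V := fun V => Real.sqrt_nonneg _
  set c := ν.real {V : SUg N | D V < δ / 4} with hc
  have hcpos : 0 < c := ball_pos hν (δ / 4) (by positivity)
  set a : ℝ := 4 * N - (δ / 2) ^ 2 with ha
  set b : ℝ := 4 * N - (δ / 4) ^ 2 with hb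
  have ha0 : 0 ≤ a := by nlinarith
  have hb0 : 0 < b := by nlinarith
  have hab : a < b := by nlinarith
  obtain ⟨n, hn⟩ : ∃ n : ℕ, (a / b) ^ n < δ * c / (8 * N) :=
    exists_pow_lt_of_lt_one (by positivity) (by rwa [div_lt_one hb0])
  rw [div_pow, div_lt_iff₀ (by positivity)] at hn
  have hknc : Continuous fun V => k V ^ n := hkc.pow n
  set Z := ∫ V, k V ^ n ∂ν with hZ
  have hZb : c * b ^ n ≤ Z := by
    have hms : MeasurableSet {V : SUg N | D V < δ / 4} :=
      (isOpen_lt hDc continuous_const).measurableSet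
    have h1 : ∫ V, Set.indicator {V : SUg N | D V < δ / 4} (fun _ => b ^ n) V ∂ν = c * b ^ n := by
      rw [integral_indicator_const _ hms, smul_eq_mul]
    rw [← h1]
    refine integral_mono ((integrable_const _).indicator hms) (integ_cont ν hknc) fun V => ?_
    by_cases hV : V ∈ {V : SUg N | D V < δ / 4}
    · rw [Set.indicator_of_mem hV]
      refine pow_le_pow_left₀ hb0.le ?_ n
      rw [hkD, hb]
      have h3 : D V < δ / 4 := hV
      have := hD0 V
      nlinarith
    · rw [Set.indicator_of_notMem hV]
      exact pow_nonneg (hk0 V) n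
  have hZpos : 0 < Z := lt_of_lt_of_le (by positivity) hZb
  have hDk : ∫ V, D V * k V ^ n ∂ν ≤ δ * Z := by
    have h1 : ∀ V, D V * k V ^ n ≤ δ / 2 * k V ^ n + 4 * N * a ^ n := by
      intro V
      by_cases hV : D V < δ / 2
      · have h2 := mul_le_mul_of_nonneg_right hV.le (pow_nonneg (hk0 V) n)
        have h3 : 0 ≤ 4 * N * a ^ n := by positivity
        linarith
      · push Not at hV
        have h2 : k V ^ n ≤ a ^ n := pow_le_pow_left₀ (hk0 V) (by rw [hkD, ha]; nlinarith) n
        have h3 : D V ≤ 4 * N := by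
          have h4 := hk0 V
          rw [hkD] at h4
          nlinarith [hD0 V]
        have h4 := mul_le_mul h3 h2 (pow_nonneg (hk0 V) n) (by positivity)
        have h5 : 0 ≤ δ / 2 * k V ^ n := mul_nonneg (by positivity) (pow_nonneg (hk0 V) n)
        linarith
    have h2 : ∫ V, D V * k V ^ n ∂ν ≤ ∫ V, (δ / 2 * k V ^ n + 4 * N * a ^ n) ∂ν :=
      integral_mono (integ_cont ν (hDc.mul hknc))
        (integ_cont ν ((continuous_const.mul hknc).add continuous_const)) h1
    have h2i : Integrable (fun V => δ / 2 * k V ^ n) ν := integ_cont ν (continuous_const.mul hknc)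
    rw [integral_add h2i (integrable_const _), integral_const_mul, ← hZ] at h2
    simp only [integral_const, probReal_univ, one_smul] at h2
    have h3 : 4 * N * a ^ n ≤ δ / 2 * (c * b ^ n) := by
      have h4 := mul_le_mul_of_nonneg_left hn.le (show (0 : ℝ) ≤ 4 * N by positivity)
      refine h4.trans_eq ?_
      field_simp
      norm_num
    have h4 := mul_le_mul_of_nonneg_left hZb (show 0 ≤ δ / 2 by positivity)
    linarith
  obtain ⟨P, hP⟩ := kap_poly ν n F hFc
  have hPe : ∀ U : SUg N, ev (U : Mat N) P = ∫ V, F (U * V) * k V ^ n ∂ν := by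
    intro U
    have hcc : Continuous fun V => F V * kap U V ^ n := hFc.mul ((continuous_kap U).pow n)
    rw [hP, ← hν.int U hcc]
    refine integral_congr_ae (Filter.Eventually.of_forall fun V => ?_)
    have h1 := kap_mul_left U 1 V
    rw [mul_one] at h1
    simp only [h1, hk]
  have hFU : ∀ U, Continuous fun V => F (U * V) := fun U => hFc.comp (continuous_const_mul U)
  have hFi : ∀ U, Integrable (fun V => F (U * V) * k V ^ n) ν := fun U =>
    integ_cont ν ((hFU U).mul hknc)
  have hFi2 : ∀ U, Integrable (fun V => F U * k V ^ n) ν := fun U =>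
    integ_cont ν (continuous_const.mul hknc)
  have hev : ∀ U : SUg N, ev (U : Mat N) (Z⁻¹ • P) = Z⁻¹ * ∫ V, F (U * V) * k V ^ n ∂ν := by
    intro U
    rw [map_smul, hPe, smul_eq_mul]
  refine ⟨Z⁻¹ • P, fun U U' => ?_, fun U => ?_⟩
  · rw [hev, hev, ← mul_sub, ← integral_sub (hFi U) (hFi U'), abs_mul, abs_of_pos (inv_pos.mpr hZpos),
      inv_mul_le_iff₀ hZpos]
    refine abs_integral_le_integral_abs.trans ?_
    rw [hZ, mul_comm, ← integral_const_mul]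
    refine integral_mono (integ_cont ν (((hFU U).mul hknc).sub ((hFU U').mul hknc)).abs)
      (integ_cont ν (continuous_const.mul hknc)) fun V => ?_
    simp only
    rw [← sub_mul, abs_mul, abs_of_nonneg (pow_nonneg (hk0 V) n)]
    refine mul_le_mul_of_nonneg_right ((hF _ _).trans_eq ?_) (pow_nonneg (hk0 V) n)
    exact hsDist_mul_right (U : Mat N) (U' : Mat N) V
  · have h1 : F U = Z⁻¹ * ∫ V, F U * k V ^ n ∂ν := by
      rw [integral_const_mul, ← hZ]
      field_simp
    rw [hev, h1, ← mul_sub, ← integral_sub (hFi U) (hFi2 U), abs_mul, abs_of_pos (inv_pos.mpr hZpos),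
      inv_mul_le_iff₀ hZpos, mul_comm Z]
    refine abs_integral_le_integral_abs.trans (le_trans ?_ hDk)
    refine integral_mono (integ_cont ν (((hFU U).mul hknc).sub (continuous_const.mul hknc)).abs)
      (integ_cont ν (hDc.mul hknc)) fun V => ?_
    simp only
    rw [← sub_mul, abs_mul, abs_of_nonneg (pow_nonneg (hk0 V) n)]
    refine mul_le_mul_of_nonneg_right ((hF _ _).trans_eq ?_) (pow_nonneg (hk0 V) n)
    have h2 := hsDist_mul_left (V : Mat N) ((1 : SUg N) : Mat N) U
    rw [hsDist_comm (V : Mat N)] at h2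
    refine Eq.trans ?_ h2
    simp

end approx

end SUConc

namespace SUConc

section core
variable {N : ℕ} [MeasurableSpace (SUg N)] [BorelSpace (SUg N)]

lemma continuous_of_lip (F : SUg N → ℝ)
    (hF : ∀ U V : SUg N, |F U - F V| ≤ hsDist (U : Mat N) (V : Mat N)) : Continuous F := by
  rw [continuous_iff_continuousAt]
  intro U
  rw [ContinuousAt, tendsto_iff_norm_sub_tendsto_zero]
  have h1 : Filter.Tendsto (fun V : SUg N => hsDist (U : Mat N) (V : Mat N)) (nhds U) (nhds 0) := by
    have := (continuous_dist_one U).tendsto U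
    rwa [hsDist_self] at this
  refine squeeze_zero (fun _ => norm_nonneg _) (fun V => ?_) h1
  rw [Real.norm_eq_abs, hsDist_comm]
  exact hF V U

lemma laplace_lip {ν : Measure (SUg N)} [IsProbabilityMeasure ν] (hν : LInv ν) (hN : 0 < N) (l : ℝ)
    (F : SUg N → ℝ) (hF : ∀ U V : SUg N, |F U - F V| ≤ hsDist (U : Mat N) (V : Mat N)) :
    ∫ U, Real.exp (l * F U) ∂ν ≤ Real.exp (l ^ 2 / N + l * ∫ U, F U ∂ν) := by
  have hFc := continuous_of_lip F hF
  have key : ∀ δ : ℝ, 0 < δ → δ ≤ 1 → ∫ U, Real.exp (l * F U) ∂ν ≤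
      Real.exp (2 * |l| * δ + (l ^ 2 / N + l * ∫ U, F U ∂ν)) := by
    intro δ hδ hδ1
    obtain ⟨p, hp, hpF⟩ := approx_poly hν hN F hFc hF δ hδ hδ1
    have hi : Integrable (fun U : SUg N => ev (U : Mat N) p) ν := integ_cont ν (continuous_evG p)
    have hEi : Integrable (fun U : SUg N => Real.exp (l * ev (U : Mat N) p)) ν :=
      integ_cont ν (Real.continuous_exp.comp (continuous_const.mul (continuous_evG p)))
    have hFi : Integrable F ν := integ_cont ν hFc
    have hb : ∀ x : ℝ, |x| ≤ δ → l * x ≤ |l| * δ := fun x hx =>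
      (le_abs_self _).trans (by rw [abs_mul]; exact mul_le_mul_of_nonneg_left hx (abs_nonneg _))
    have h1 : ∫ U, Real.exp (l * F U) ∂ν ≤
        ∫ U : SUg N, Real.exp (|l| * δ) * Real.exp (l * ev (U : Mat N) p) ∂ν := by
      refine integral_mono (integ_cont ν (Real.continuous_exp.comp (continuous_const.mul hFc)))
        (hEi.const_mul _) fun U => ?_
      simp only
      rw [← Real.exp_add]
      refine Real.exp_le_exp.mpr ?_
      have := hb (F U - ev (U : Mat N) p) (by rw [abs_sub_comm]; exact hpF U)
      linarith
    have h2 : l * ∫ U : SUg N, ev (U : Mat N) p ∂ν ≤ |l| * δ + l * ∫ U, F U ∂ν := by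
      have h3 : |∫ U : SUg N, ev (U : Mat N) p ∂ν - ∫ U, F U ∂ν| ≤ δ := by
        rw [← integral_sub hi hFi]
        refine abs_integral_le_integral_abs.trans ?_
        have h4 : ∫ U : SUg N, |ev (U : Mat N) p - F U| ∂ν ≤ ∫ _ : SUg N, δ ∂ν :=
          integral_mono (hi.sub hFi).abs (integrable_const _) hpF
        simpa using h4
      have := hb _ h3
      linarith
    rw [integral_const_mul] at h1
    refine h1.trans ((mul_le_mul_of_nonneg_left (laplace_poly hν hN l p hp)
      (Real.exp_pos _).le).trans ?_)
    rw [← Real.exp_add]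
    refine Real.exp_le_exp.mpr ?_
    linarith
  have hlim : Filter.Tendsto (fun δ : ℝ => Real.exp (2 * |l| * δ + (l ^ 2 / N + l * ∫ U, F U ∂ν)))
      (nhdsWithin 0 (Set.Ioi 0)) (nhds (Real.exp (l ^ 2 / N + l * ∫ U, F U ∂ν))) := by
    have hc : Continuous fun δ : ℝ => Real.exp (2 * |l| * δ + (l ^ 2 / N + l * ∫ U, F U ∂ν)) := by
      fun_prop
    have := (hc.tendsto 0).mono_left (nhdsWithin_le_nhds (s := Set.Ioi (0 : ℝ)))
    simpa using this
  refine ge_of_tendsto hlim ?_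
  filter_upwards [Ioc_mem_nhdsGT (zero_lt_one (α := ℝ))] with δ hδ
  exact key δ hδ.1 hδ.2

lemma gauss_bound (hN : 0 < N) {a x : ℝ} (ha : 0 < a) (h : a ≤ Real.exp (-(N * x ^ 2 / 4))) :
    x ≤ Real.sqrt (4 / N) * Real.sqrt (Real.log (1 / a)) := by
  have hNr : (0 : ℝ) < N := by exact_mod_cast hN
  rw [← Real.sqrt_mul (by positivity)]
  refine Real.le_sqrt_of_sq_le ?_
  rw [← Real.log_le_iff_le_exp ha] at h
  rw [one_div, Real.log_inv, div_mul_eq_mul_div, le_div_iff₀ hNr]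
  linarith

lemma core {ν : Measure (SUg N)} [IsProbabilityMeasure ν] (hν : LInv ν) (hN : 0 < N) (A B : Set (SUg N))
    (a b ε : ℝ) (ha : 0 < a) (hb : 0 < b) (hA : a ≤ ν.real A) (hB : b ≤ ν.real B)
    (hAB : ∀ U ∈ B, ∀ V ∈ A, ε ≤ hsDist (U : Mat N) (V : Mat N)) :
    ε ≤ Real.sqrt (4 / N) * (Real.sqrt (Real.log (1 / a)) + Real.sqrt (Real.log (1 / b))) := by
  have hNr : (0 : ℝ) < N := by exact_mod_cast hN
  have hAne : A.Nonempty := by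
    by_contra h
    rw [Set.not_nonempty_iff_eq_empty] at h
    rw [h] at hA
    simp at hA
    linarith
  haveI : Nonempty A := hAne.to_subtype
  set F : SUg N → ℝ := fun U => ⨅ V : A, hsDist (U : Mat N) ((V : SUg N) : Mat N) with hFdef
  have hbdd : ∀ U : SUg N, BddBelow (Set.range fun V : A => hsDist (U : Mat N) ((V : SUg N) : Mat N)) :=
    fun U => ⟨0, by rintro _ ⟨V, rfl⟩; exact Real.sqrt_nonneg _⟩
  have hF1 : ∀ U V : SUg N, F U ≤ hsDist (U : Mat N) (V : Mat N) + F V := by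
    intro U V
    rw [← sub_le_iff_le_add']
    refine le_ciInf fun W => ?_
    rw [sub_le_iff_le_add']
    exact (ciInf_le (hbdd U) W).trans (hsDist_triangle _ _ _)
  have hF : ∀ U V : SUg N, |F U - F V| ≤ hsDist (U : Mat N) (V : Mat N) := by
    intro U V
    rw [abs_sub_le_iff]
    have h1 := hF1 U V
    have h2 := hF1 V U
    rw [hsDist_comm] at h2
    constructor <;> linarith
  have hFc := continuous_of_lip F hF
  have hFA : ∀ U ∈ A, F U ≤ 0 := fun U hU =>
    (ciInf_le (hbdd U) ⟨U, hU⟩).trans_eq (hsDist_self _)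
  have hFB : ∀ U ∈ B, ε ≤ F U := fun U hU => le_ciInf fun V => hAB U hU V V.2
  have hEi : ∀ l : ℝ, Integrable (fun U => Real.exp (l * F U)) ν := fun l =>
    integ_cont ν (Real.continuous_exp.comp (continuous_const.mul hFc))
  have hm0 : 0 ≤ ∫ U, F U ∂ν := integral_nonneg fun U => Real.iInf_nonneg fun V => Real.sqrt_nonneg _
  set m := ∫ U, F U ∂ν with hm
  have hma : m ≤ Real.sqrt (4 / N) * Real.sqrt (Real.log (1 / a)) := by
    refine gauss_bound hN ha ?_
    have h1 := mul_meas_ge_le_integral_of_nonneg (μ := ν)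
      (Filter.Eventually.of_forall fun U => (Real.exp_pos (-(N * m / 2) * F U)).le) (hEi _) 1
    have h2 : ν.real A ≤ ν.real {U | 1 ≤ Real.exp (-(N * m / 2) * F U)} := by
      refine measureReal_mono fun U hU => ?_
      refine Real.one_le_exp ?_
      have h3 : 0 ≤ N * m / 2 := by positivity
      have := hFA U hU
      nlinarith
    have h4 := laplace_lip hν hN (-(N * m / 2)) F hF
    rw [← hm] at h4
    rw [one_mul] at h1
    refine hA.trans (h2.trans (h1.trans (h4.trans_eq ?_)))
    congr 1
    field_simp
    ring
  have hmb : ε - m ≤ Real.sqrt (4 / N) * Real.sqrt (Real.log (1 / b)) := by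
    by_cases hε : ε ≤ m
    · exact (sub_nonpos.mpr hε).trans (by positivity)
    push Not at hε
    refine gauss_bound hN hb ?_
    have h0 : 0 ≤ N * (ε - m) / 2 := by
      have := sub_pos.mpr hε
      positivity
    have h1 := mul_meas_ge_le_integral_of_nonneg (μ := ν)
      (Filter.Eventually.of_forall fun U => (Real.exp_pos ((N * (ε - m) / 2) * F U)).le) (hEi _)
      (Real.exp ((N * (ε - m) / 2) * ε))
    have h2 : ν.real B ≤ ν.real {U | Real.exp ((N * (ε - m) / 2) * ε) ≤
        Real.exp ((N * (ε - m) / 2) * F U)} := by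
      refine measureReal_mono fun U hU => ?_
      exact Real.exp_le_exp.mpr (mul_le_mul_of_nonneg_left (hFB U hU) h0)
    have h4 := laplace_lip hν hN (N * (ε - m) / 2) F hF
    rw [← hm] at h4
    have h5 := (mul_le_mul_of_nonneg_left (hB.trans h2)
      (Real.exp_pos ((N * (ε - m) / 2) * ε)).le).trans (h1.trans h4)
    rw [← le_div_iff₀' (Real.exp_pos _), ← Real.exp_sub] at h5
    refine h5.trans_eq ?_
    congr 1
    field_simp
    ring
  rw [mul_add]
  linarith

end core

lemma exists_split {Ω L : Type*} [MeasurableSpace Ω] [Countable L] (ν : Measure Ω)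
    [IsProbabilityMeasure ν] (h : Ω → L) (hmeas : ∀ l : L, MeasurableSet (h ⁻¹' {l})) (η : ℝ)
    (hη0 : 0 < η) (hη1 : η ≤ 1 / 2) (hclass : ∀ l, ν.real (h ⁻¹' {l}) ≤ 1 - η) :
    ∃ M : Set L, MeasurableSet (h ⁻¹' M) ∧ η / 2 ≤ ν.real (h ⁻¹' M) ∧
      ν.real (h ⁻¹' M) ≤ 1 - η / 2 := by
  have hM : ∀ M : Set L, MeasurableSet (h ⁻¹' M) := by
    intro M
    rw [← Set.biUnion_preimage_singleton]
    exact MeasurableSet.biUnion M.to_countable fun l _ => hmeas l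
  by_cases hbig : ∃ l, η / 2 ≤ ν.real (h ⁻¹' {l})
  · obtain ⟨l, hl⟩ := hbig
    exact ⟨{l}, hM _, hl, (hclass l).trans (by linarith)⟩
  push Not at hbig
  haveI : Nonempty Ω := nonempty_of_isProbabilityMeasure ν
  haveI : Nonempty L := Nonempty.map h inferInstance
  obtain ⟨e, he⟩ := exists_surjective_nat L
  let S : ℕ → Set L := fun n => e '' Set.Iio n
  have hex : ∃ n, η / 2 ≤ ν.real (h ⁻¹' S n) := by
    by_contra hno
    push Not at hno
    have hmono : Monotone fun n => h ⁻¹' S n := fun i j hij =>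
      Set.preimage_mono (Set.image_mono (Set.Iio_subset_Iio hij))
    have hU : (⋃ n, h ⁻¹' S n) = Set.univ := by
      refine Set.eq_univ_of_forall fun x => ?_
      obtain ⟨k, hk⟩ := he (h x)
      exact Set.mem_iUnion.mpr ⟨k + 1, k, Nat.lt_succ_self k, hk⟩
    have h1 := hmono.measure_iUnion (μ := ν)
    rw [hU, measure_univ] at h1
    have h2 : (⨆ n, ν (h ⁻¹' S n)) ≤ ENNReal.ofReal (η / 2) := by
      refine iSup_le fun n => ?_
      rw [← ofReal_measureReal]
      exact ENNReal.ofReal_le_ofReal (hno n).le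
    rw [← h1, ENNReal.one_le_ofReal] at h2
    linarith
  classical
  obtain ⟨hn, hmin⟩ : η / 2 ≤ ν.real (h ⁻¹' S (Nat.find hex)) ∧
      ∀ k < Nat.find hex, ν.real (h ⁻¹' S k) < η / 2 :=
    ⟨Nat.find_spec hex, fun k hk => not_le.mp (Nat.find_min hex hk)⟩
  refine ⟨S (Nat.find hex), hM _, hn, ?_⟩
  rcases hnk : Nat.find hex with _ | k
  · simp [S]
    linarith
  · have h1 : h ⁻¹' S (k + 1) ⊆ h ⁻¹' S k ∪ h ⁻¹' {e k} := by
      rintro x ⟨i, hi, hix⟩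
      rcases Nat.lt_succ_iff_lt_or_eq.mp hi with h2 | h2
      · exact Or.inl ⟨i, h2, hix⟩
      · right
        rw [h2] at hix
        exact hix.symm
    have h2 := (measureReal_mono (μ := ν) h1).trans (measureReal_union_le _ _)
    have h3 := hmin k (by omega)
    have h4 := hbig (e k)
    linarith

end SUConc

/-- prediction-change adversarial robustness of any classifier of
Haar-randomly drawn special unitaries. -/
theorem stmt0 (N : ℕ) (hN : 2 ≤ N) {L : Type*} [Countable L]
    [MeasurableSpace (Matrix.specialUnitaryGroup (Fin N) ℂ)]
    [BorelSpace (Matrix.specialUnitaryGroup (Fin N) ℂ)]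
    (ν : Measure (Matrix.specialUnitaryGroup (Fin N) ℂ)) [IsProbabilityMeasure ν]
    -- `ν` is the (normalized) Haar measure: a left-invariant probability measure.
    (hHaar : ∀ (W : Matrix.specialUnitaryGroup (Fin N) ℂ)
      (S : Set (Matrix.specialUnitaryGroup (Fin N) ℂ)), MeasurableSet S →
      ν ((fun U => W * U) ⁻¹' S) = ν S)
    (h : Matrix.specialUnitaryGroup (Fin N) ℂ → L)
    (hmeas : ∀ l : L, MeasurableSet (h ⁻¹' {l}))
    (η γ ε : ℝ) (hη : η ∈ Set.Ioc (0 : ℝ) (1/2)) (hγ : γ ∈ Set.Ioc (0 : ℝ) 1)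
    (hclass : ∀ l : L, ν (h ⁻¹' {l}) ≤ ENNReal.ofReal (1 - η))
    (hrisk : ν {U | sInf {r : ℝ | ∃ V, h V ≠ h U ∧
        r = hsDist (U : Matrix (Fin N) (Fin N) ℂ) (V : Matrix (Fin N) (Fin N) ℂ)} ≤ ε}
      ≤ ENNReal.ofReal (1 - γ)) :
    ε ≤ Real.sqrt (4 / N) * (Real.sqrt (Real.log (2 * Real.sqrt 2 / η)) +
      Real.sqrt (Real.log (2 * Real.sqrt 2 / γ))) := by
  have hN0 : 0 < N := by omega
  obtain ⟨hη0, hη1⟩ := hη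
  obtain ⟨hγ0, hγ1⟩ := hγ
  have hclass' : ∀ l, ν.real (h ⁻¹' {l}) ≤ 1 - η := fun l =>
    ENNReal.toReal_le_of_le_ofReal (by linarith) (hclass l)
  have hrisk' := ENNReal.toReal_le_of_le_ofReal (by linarith) hrisk
  set E := {U : Matrix.specialUnitaryGroup (Fin N) ℂ | sInf {r : ℝ | ∃ V, h V ≠ h U ∧
        r = hsDist (U : Matrix (Fin N) (Fin N) ℂ) (V : Matrix (Fin N) (Fin N) ℂ)} ≤ ε} with hE
  change ν.real E ≤ 1 - γ at hrisk'
  obtain ⟨M, hMm, hM1, hM2⟩ := SUConc.exists_split ν h hmeas η hη0 hη1 hclass'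
  have hfar : ∀ U V, U ∉ E → h V ≠ h U →
      ε ≤ hsDist (U : Matrix (Fin N) (Fin N) ℂ) (V : Matrix (Fin N) (Fin N) ℂ) := by
    intro U V hU hne
    by_contra hlt
    push Not at hlt
    have hle : sInf {r : ℝ | ∃ V, h V ≠ h U ∧
        r = hsDist (U : Matrix (Fin N) (Fin N) ℂ) (V : Matrix (Fin N) (Fin N) ℂ)} ≤
        hsDist (U : Matrix (Fin N) (Fin N) ℂ) (V : Matrix (Fin N) (Fin N) ℂ) := by
      refine csInf_le ⟨0, ?_⟩ ⟨V, hne, rfl⟩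
      rintro _ ⟨W, -, rfl⟩
      exact Real.sqrt_nonneg _
    exact hU (hle.trans hlt.le)
  have hcompl : ν.real (h ⁻¹' M)ᶜ = 1 - ν.real (h ⁻¹' M) := by
    rw [measureReal_compl hMm, probReal_univ]
  have hmain : ε ≤ Real.sqrt (4 / N) * (Real.sqrt (Real.log (1 / (η / 2))) +
      Real.sqrt (Real.log (1 / (γ / 2)))) := by
    have hsplit : 1 ≤ ν.real E + (ν.real (Eᶜ ∩ h ⁻¹' M) + ν.real (Eᶜ ∩ (h ⁻¹' M)ᶜ)) := by
      have h1 : (Set.univ : Set (Matrix.specialUnitaryGroup (Fin N) ℂ)) ⊆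
          E ∪ ((Eᶜ ∩ h ⁻¹' M) ∪ (Eᶜ ∩ (h ⁻¹' M)ᶜ)) := by
        intro U _
        by_cases h1 : U ∈ E
        · exact Or.inl h1
        · by_cases h2 : U ∈ h ⁻¹' M
          · exact Or.inr (Or.inl ⟨h1, h2⟩)
          · exact Or.inr (Or.inr ⟨h1, h2⟩)
      have h2 := measureReal_mono (μ := ν) h1
      rw [probReal_univ] at h2
      have h3 := measureReal_union_le (μ := ν) E ((Eᶜ ∩ h ⁻¹' M) ∪ (Eᶜ ∩ (h ⁻¹' M)ᶜ))
      have h4 := measureReal_union_le (μ := ν) (Eᶜ ∩ h ⁻¹' M) (Eᶜ ∩ (h ⁻¹' M)ᶜ)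
      linarith
    by_cases hcase : γ / 2 ≤ ν.real (Eᶜ ∩ h ⁻¹' M)
    · refine SUConc.core hHaar hN0 (h ⁻¹' M)ᶜ (Eᶜ ∩ h ⁻¹' M) (η / 2) (γ / 2) ε (by linarith)
        (by linarith) (by linarith) hcase ?_
      intro U hU V hV
      refine hfar U V hU.1 fun heq => hV ?_
      rw [Set.mem_preimage, heq]
      exact hU.2
    · push Not at hcase
      refine SUConc.core hHaar hN0 (h ⁻¹' M) (Eᶜ ∩ (h ⁻¹' M)ᶜ) (η / 2) (γ / 2) ε (by linarith)
        (by linarith) hM1 (by linarith) ?_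
      intro U hU V hV
      refine hfar U V hU.1 fun heq => hU.2 ?_
      rw [Set.mem_preimage, ← heq]
      exact hV
  have hlog : ∀ x : ℝ, 0 < x → Real.log (1 / (x / 2)) ≤ Real.log (2 * Real.sqrt 2 / x) := by
    intro x hx
    refine Real.log_le_log (by positivity) ?_
    rw [one_div_div]
    refine div_le_div_of_nonneg_right ?_ hx.le
    have : 1 ≤ Real.sqrt 2 := Real.one_le_sqrt.mpr (by norm_num)
    linarith
  refine hmain.trans (mul_le_mul_of_nonneg_left (add_le_add ?_ ?_) (Real.sqrt_nonneg _))
  · exact Real.sqrt_le_sqrt (hlog η hη0)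
  · exact Real.sqrt_le_sqrt (hlog γ hγ0)

end
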